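/- arXiv:2002.00342 — 3 statements merged into one kernel-verified Lean document; each statement's English description precedes it below -/
import Mathlib

section
/- (Rodgers–Tao, Newman's conjecture Λ ≥ 0) For every real λ < 0 there exists z ∈ ℂ with Im z ≠ 0 and H(λ, z) = 0. Equivalently, the De Bruijn–Newman constant is nonnegative: Λ ≥ 0. -/
open MeasureTheory

noncomputable section

/-- `Φ(u) = Σ_{n=1}^∞ (2π²n⁴e^{9u} − 3πn²e^{5u}) exp(−πn²e^{4u})`. -/
def Phi (u : ℝ) : ℝ :=
  ∑' n : ℕ,
    (2 * Real.pi ^ 2 * ((n : ℝ) + 1) ^ 4 * Real.exp (9 * u)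
        - 3 * Real.pi * ((n : ℝ) + 1) ^ 2 * Real.exp (5 * u))
      * Real.exp (-Real.pi * ((n : ℝ) + 1) ^ 2 * Real.exp (4 * u))

/-- The deformed xi function `H(λ, z) = ∫_0^∞ e^{λu²} Φ(u) cos(uz) du`; one has
`H(0, z) = (1/8) ξ(1/2 + iz/2)`, where `ξ` is the Riemann xi function. -/
def H (lam : ℝ) (z : ℂ) : ℂ :=
  ∫ u in Set.Ioi (0 : ℝ),
    ((Real.exp (lam * u ^ 2) * Phi u : ℝ) : ℂ) * Complex.cos ((u : ℂ) * z)

namespace DeBruijnNewman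

/-! For `λ = -1/a < 0`, high up the function `H λ` is approximated, after a shift and up to a
nonvanishing factor, by the almost periodic entire function
`gaussDirichlet a w = Σ n^{-w} exp(-(log n)² / (4a))`. This function has a zero, which recurs at
arbitrarily large heights, and Hurwitz's theorem produces zeros of `H λ` off the real axis. -/

open Filter Topology Finset

/-- The series representing the digamma function. -/
def digammaSeries (z : ℂ) : ℂ :=
  -(Real.eulerMascheroniConstant : ℂ) + ∑' k : ℕ, (1 / ((k : ℂ) + 1) - 1 / (z + k))

lemma re_add_natCast_le_norm (z : ℂ) (k : ℕ) : z.re + k ≤ ‖z + k‖ := by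
  simpa using Complex.re_le_norm (z + k)

lemma summable_inv_succ_sq : Summable fun k : ℕ => 1 / ((k : ℝ) + 1) ^ 2 := by
  have := (summable_nat_add_iff 1).2 (Real.summable_one_div_nat_pow.2 (by norm_num : 1 < 2))
  simpa using this

lemma summable_digammaSeries {z : ℂ} (hz : 1 ≤ z.re) :
    Summable fun k : ℕ => (1 / ((k : ℂ) + 1) - 1 / (z + k)) := by
  refine Summable.of_norm_bounded (summable_inv_succ_sq.mul_left ‖z - 1‖) fun k => ?_
  have h1 := re_add_natCast_le_norm z k
  have hk : (0 : ℝ) < (k : ℝ) + 1 := by positivity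
  have h2 : (k : ℝ) + 1 ≤ ‖z + k‖ := by linarith
  have h3 : z + k ≠ 0 := norm_pos_iff.1 (hk.trans_le h2)
  have h4 : (k : ℂ) + 1 ≠ 0 := Nat.cast_add_one_ne_zero k
  have : (1 / ((k : ℂ) + 1) - 1 / (z + k)) = (z - 1) / ((k + 1) * (z + k)) := by
    field_simp; ring
  have h5 : ‖(k : ℂ) + 1‖ = k + 1 := by
    exact_mod_cast Complex.norm_natCast (k + 1)
  rw [this, norm_div, norm_mul, h5, mul_one_div, sq]
  gcongr

lemma tendsto_log_sub_sum_inv {z : ℂ} (hz : 1 ≤ z.re) :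
    Tendsto (fun n : ℕ => (Real.log n : ℂ) - ∑ k ∈ range (n + 1), 1 / (z + k)) atTop
      (𝓝 (digammaSeries z)) := by
  have h1 := (Complex.continuous_ofReal.tendsto _).comp Real.tendsto_harmonic_sub_log
  have h2 := (summable_digammaSeries hz).hasSum.tendsto_sum_nat.comp (tendsto_add_atTop_nat 1)
  have h3 : Tendsto (fun n : ℕ => 1 / ((n : ℂ) + 1)) atTop (𝓝 0) :=
    tendsto_one_div_add_atTop_nhds_zero_nat
  have := (h1.neg.add h2).sub h3
  rw [sub_zero] at this
  refine this.congr fun n => ?_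
  simp only [Function.comp, sum_sub_distrib]
  rw [sum_range_succ (fun k : ℕ => 1 / ((k : ℂ) + 1))]
  simp [harmonic]
  ring

/-- The general factor of the product for `Γ(z + iθ) / Γ(z) * exp(-iθ ψ(z))`. -/
def gammaFactor (z : ℂ) (θ : ℝ) : ℂ :=
  (1 - Complex.I * θ / (z + Complex.I * θ)) * Complex.exp (Complex.I * θ / z)

/-- The quotient `Γ(z + iθ) / Γ(z)`, normalised by its first order behaviour. -/
def gammaRatio (z : ℂ) (θ : ℝ) : ℂ :=
  Complex.Gamma (z + Complex.I * θ) / Complex.Gamma z *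
    Complex.exp (-(Complex.I * θ * digammaSeries z))

lemma norm_one_sub_le (v : ℂ) : ‖1 - v‖ ≤ Real.exp (-v.re + ‖v‖ ^ 2 / 2) := by
  have h : ‖1 - v‖ ^ 2 = 1 + (-2 * v.re + ‖v‖ ^ 2) := by
    rw [← Complex.normSq_eq_norm_sq, ← Complex.normSq_eq_norm_sq, Complex.normSq_apply,
      Complex.normSq_apply]
    simp; ring
  have h2 : ‖1 - v‖ ^ 2 ≤ (Real.exp (-v.re + ‖v‖ ^ 2 / 2)) ^ 2 := by
    rw [h, ← Real.exp_nat_mul]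
    refine (le_of_eq (add_comm _ _)).trans ((Real.add_one_le_exp _).trans (le_of_eq ?_))
    congr 1; push_cast; ring
  exact le_of_sq_le_sq h2 (Real.exp_nonneg _) 

lemma add_I_mul_ne_zero {z : ℂ} (hz : 0 < z.re) (θ : ℝ) : z + Complex.I * θ ≠ 0 := by
  intro h
  have := congrArg Complex.re h
  simp at this
  linarith

lemma ne_zero_of_zero_lt_re {z : ℂ} (hz : 0 < z.re) : z ≠ 0 := by
  rintro rfl
  simp at hz

lemma norm_gammaFactor_le {z : ℂ} (hz : 0 < z.re) (θ : ℝ) :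
    ‖gammaFactor z θ‖ ≤ Real.exp (3 / 2 * θ ^ 2 * (1 / z.re ^ 2)) := by
  have h1 := add_I_mul_ne_zero hz θ
  have h0 := ne_zero_of_zero_lt_re hz
  set w := z + Complex.I * θ with hw
  have hzn : z.re ≤ ‖z‖ := Complex.re_le_norm z
  have hwn : z.re ≤ ‖w‖ := by
    have := Complex.re_le_norm w
    simpa [hw] using this
  set v := Complex.I * θ / w with hv
  set u := Complex.I * θ / z with hu
  have huv : u - v = u * v := by
    rw [hu, hv, hw]
    rw [hw] at h1
    field_simp
    ring
  have hun : ‖u‖ ≤ |θ| / z.re := by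
    rw [hu, norm_div]; simp only [norm_mul, Complex.norm_I, one_mul, Complex.norm_real,
      Real.norm_eq_abs]
    gcongr
  have hvn : ‖v‖ ≤ |θ| / z.re := by
    rw [hv, norm_div]; simp only [norm_mul, Complex.norm_I, one_mul, Complex.norm_real,
      Real.norm_eq_abs]
    gcongr
  have hs : (|θ| / z.re) ^ 2 = θ ^ 2 * (1 / z.re ^ 2) := by
    rw [div_pow, sq_abs]; ring
  rw [gammaFactor, norm_mul, Complex.norm_exp]
  calc _ ≤ Real.exp (-v.re + ‖v‖ ^ 2 / 2) * Real.exp u.re := by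
        gcongr; exact norm_one_sub_le v
    _ = Real.exp ((u - v).re + ‖v‖ ^ 2 / 2) := by
        rw [← Real.exp_add, Complex.sub_re]; ring_nf
    _ ≤ _ := by
        apply Real.exp_le_exp.2
        have a1 : (u - v).re ≤ (|θ| / z.re) ^ 2 := by
          rw [huv, sq]
          refine (Complex.re_le_norm _).trans ?_
          rw [norm_mul]
          gcongr
        have a2 : ‖v‖ ^ 2 ≤ (|θ| / z.re) ^ 2 := by gcongr
        rw [hs] at a1 a2
        linarith

lemma norm_gammaFactor_sub_one_le {z : ℂ} (hz : 1 ≤ z.re) (θ : ℝ) :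
    ‖gammaFactor z θ - 1‖ ≤ (1 + |θ|) * (θ ^ 2 * Real.exp |θ|) * (1 / ‖z‖ ^ 2) := by
  have hz' : 0 < z.re := by linarith
  have h1 := add_I_mul_ne_zero hz' θ
  have h0 := ne_zero_of_zero_lt_re hz'
  set w := z + Complex.I * θ with hw
  have hzn : 1 ≤ ‖z‖ := hz.trans (Complex.re_le_norm z)
  have hwn : 1 ≤ ‖w‖ := by
    have := Complex.re_le_norm w
    simp [hw] at this
    linarith
  set v := Complex.I * θ / w with hv
  set u := Complex.I * θ / z with hu
  have huv : (1 - v) * (1 + u) = 1 := by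
    rw [hu, hv, hw]
    rw [hw] at h1
    field_simp
    ring
  have hun' : ‖u‖ = |θ| / ‖z‖ := by
    rw [hu, norm_div]; simp only [norm_mul, Complex.norm_I, one_mul, Complex.norm_real,
      Real.norm_eq_abs]
  have hun : ‖u‖ ≤ |θ| := hun'.le.trans (div_le_self (abs_nonneg _) hzn)
  have hvn : ‖v‖ ≤ |θ| := by
    rw [hv, norm_div]; simp only [norm_mul, Complex.norm_I, one_mul, Complex.norm_real,
      Real.norm_eq_abs]
    exact div_le_self (abs_nonneg _) hwn
  have hE : gammaFactor z θ - 1 =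
      (1 - v) * (Complex.exp u - ∑ m ∈ range 2, u ^ m / m.factorial) := by
    rw [gammaFactor, ← hu, ← hw, ← hv]
    simp [sum_range_succ]
    linear_combination huv
  rw [hE, norm_mul, mul_assoc]
  gcongr
  · exact (norm_sub_le _ _).trans (by rw [norm_one]; gcongr)
  · refine (Complex.norm_exp_sub_sum_le_norm_mul_exp u 2).trans ?_
    have : θ ^ 2 * Real.exp |θ| * (1 / ‖z‖ ^ 2) = ‖u‖ ^ 2 * Real.exp |θ| := by
      rw [hun', div_pow, sq_abs]; ring
    rw [this]
    gcongr

lemma tendsto_prod_gammaFactor {z : ℂ} (hz : 1 ≤ z.re) (θ : ℝ) :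
    Tendsto (fun n : ℕ => ∏ k ∈ range (n + 1), gammaFactor (z + k) θ) atTop
      (𝓝 (gammaRatio z θ)) := by
  have hre (k : ℕ) : 0 < (z + k).re := by
    simp; have : (0 : ℝ) ≤ k := k.cast_nonneg
    linarith
  have hG : Complex.Gamma z ≠ 0 := Complex.Gamma_ne_zero_of_re_pos (by linarith)
  have h1 := ((Complex.GammaSeq_tendsto_Gamma (z + Complex.I * θ)).div
    (Complex.GammaSeq_tendsto_Gamma z) hG).mul
      (((tendsto_log_sub_sum_inv hz).const_mul (Complex.I * θ)).neg.cexp)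
  refine h1.congr' ?_
  filter_upwards [eventually_gt_atTop 0] with n hn
  have hn' : (n : ℂ) ≠ 0 := by exact_mod_cast hn.ne'
  have hp1 : ∏ j ∈ range (n + 1), (z + j) ≠ 0 :=
    prod_ne_zero_iff.2 fun k _ => ne_zero_of_zero_lt_re (hre k)
  have hp2 : ∏ j ∈ range (n + 1), (z + Complex.I * θ + j) ≠ 0 := by
    refine prod_ne_zero_iff.2 fun k _ => ?_
    have := add_I_mul_ne_zero (hre k) θ
    rwa [add_right_comm] at this
  have hf : (n.factorial : ℂ) ≠ 0 := by exact_mod_cast n.factorial_ne_zero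
  have hfac (k : ℕ) : gammaFactor (z + k) θ =
      (z + k) / (z + Complex.I * θ + k) * Complex.exp (Complex.I * θ * (1 / (z + k))) := by
    have := add_I_mul_ne_zero (hre k) θ
    rw [gammaFactor, add_right_comm z (k : ℂ), mul_one_div]
    rw [add_right_comm] at this
    congr 1
    field_simp
    ring
  simp only [Pi.div_apply, Complex.GammaSeq]
  rw [prod_congr rfl fun k _ => hfac k, prod_mul_distrib, prod_div_distrib, ← Complex.exp_sum,
    ← mul_sum, Complex.cpow_def_of_ne_zero hn', Complex.cpow_def_of_ne_zero hn', mul_sub,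
    neg_sub, Complex.exp_sub, mul_add, Complex.exp_add, Complex.ofReal_log n.cast_nonneg,
    Complex.ofReal_natCast]
  have e1 := Complex.exp_ne_zero (Complex.log n * z)
  have e2 := Complex.exp_ne_zero (Complex.log n * (Complex.I * θ))
  rw [mul_comm (Complex.I * (θ : ℂ)) (Complex.log n)]
  field_simp

lemma norm_gammaRatio_le {z : ℂ} (hz : 1 < z.re) (θ : ℝ) :
    ‖gammaRatio z θ‖ ≤ Real.exp (3 / 2 * θ ^ 2 * (1 / (z.re - 1))) := by
  refine le_of_tendsto (tendsto_prod_gammaFactor hz.le θ).norm (Eventually.of_forall fun n => ?_)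
  have hre (k : ℕ) : z.re + k = (z + k).re := by simp
  rw [norm_prod]
  calc _ ≤ ∏ k ∈ range (n + 1), Real.exp (3 / 2 * θ ^ 2 * (1 / (z + k).re ^ 2)) := by
        refine prod_le_prod (fun _ _ => norm_nonneg _) fun k _ => norm_gammaFactor_le ?_ θ
        rw [← hre]; positivity
    _ = Real.exp (3 / 2 * θ ^ 2 * ∑ k ∈ range (n + 1), (1 / (z + k).re ^ 2)) := by
        rw [← Real.exp_sum, mul_sum]
    _ ≤ _ := by
        gcongr
        have : ∀ N : ℕ, ∑ k ∈ range N, (1 / (z + k).re ^ 2) ≤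
            1 / (z.re - 1) - 1 / (z.re - 1 + N) := by
          intro N
          induction N with
          | zero => simp
          | succ N ih =>
            rw [sum_range_succ, ← hre]
            have h0 : 0 < z.re - 1 := by linarith
            have h1 : 0 < z.re - 1 + N := by positivity
            have h2 : 1 / (z.re + N) ^ 2 ≤ 1 / (z.re - 1 + N) - 1 / (z.re - 1 + (N + 1 : ℕ)) := by
              have : 1 / (z.re - 1 + N) - 1 / (z.re - 1 + (N + 1 : ℕ)) =
                  1 / ((z.re - 1 + N) * (z.re + N)) := by
                have h3 : z.re - 1 + (N + 1 : ℕ) = z.re + N := by push_cast; ring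
                rw [h3]
                have : z.re + N ≠ 0 := by linarith
                field_simp
                ring
              rw [this]
              apply one_div_le_one_div_of_le
              · have : 0 < z.re + N := by linarith
                positivity
              · rw [sq]; gcongr; linarith
            linarith
        have h0 : 0 < z.re - 1 := by linarith
        have h1 : 0 ≤ 1 / (z.re - 1 + (n + 1 : ℕ)) := by positivity
        linarith [this (n + 1)]

lemma norm_gammaRatio_sub_one_le {z : ℂ} (hz : 1 ≤ z.re) (θ : ℝ) :
    ‖gammaRatio z θ - 1‖ ≤
      Real.exp ((1 + |θ|) * (θ ^ 2 * Real.exp |θ|) * ∑' k : ℕ, 1 / ‖z + k‖ ^ 2) - 1 := by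
  refine le_of_tendsto ((tendsto_prod_gammaFactor hz θ).sub_const 1).norm
    (Eventually.of_forall fun n => ?_)
  have hk (k : ℕ) : (k : ℝ) + 1 ≤ ‖z + k‖ := by linarith [re_add_natCast_le_norm z k]
  have hs : Summable fun k : ℕ => 1 / ‖z + k‖ ^ 2 := by
    refine Summable.of_nonneg_of_le (fun _ => by positivity) (fun k => ?_) summable_inv_succ_sq
    gcongr; exact hk k
  have := norm_prod_one_add_sub_one_le (range (n + 1)) fun k => gammaFactor (z + k) θ - 1
  simp only [add_sub_cancel] at this
  refine this.trans ?_
  gcongr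
  calc _ ≤ ∑ k ∈ range (n + 1), (1 + |θ|) * (θ ^ 2 * Real.exp |θ|) * (1 / ‖z + k‖ ^ 2) := by
        refine sum_le_sum fun k _ => norm_gammaFactor_sub_one_le ?_ θ
        simp; have : (0 : ℝ) ≤ k := k.cast_nonneg
        linarith
    _ ≤ _ := by
        rw [← mul_sum]
        gcongr
        exact hs.sum_le_tsum _ fun _ _ => by positivity

lemma tendsto_gammaRatio {A : ℝ} (hA : 1 ≤ A) (θ : ℝ) :
    Tendsto (fun y : ℝ => gammaRatio (A + Complex.I * y) θ) atTop (𝓝 1) := by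
  rw [tendsto_iff_norm_sub_tendsto_zero]
  have hre (y : ℝ) : 1 ≤ ((A : ℂ) + Complex.I * y).re := by simpa
  have h1 : Tendsto (fun y : ℝ => ∑' k : ℕ, 1 / ‖(A : ℂ) + Complex.I * y + k‖ ^ 2) atTop
      (𝓝 (∑' _ : ℕ, 0)) := by
    refine tendsto_tsum_of_dominated_convergence summable_inv_succ_sq (fun k => ?_)
      (Eventually.of_forall fun y k => ?_)
    · have : Tendsto (fun y : ℝ => ‖(A : ℂ) + Complex.I * y + k‖ ^ 2) atTop atTop := by
        refine tendsto_atTop_mono (fun y => ?_) (tendsto_pow_atTop (two_ne_zero))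
        rw [← Complex.normSq_eq_norm_sq, Complex.normSq_apply]
        simp
        nlinarith [mul_self_nonneg (A + k)]
      simp only [one_div]
      exact this.inv_tendsto_atTop
    · rw [Real.norm_of_nonneg (by positivity)]
      gcongr
      linarith [re_add_natCast_le_norm ((A : ℂ) + Complex.I * y) k, hre y]
  rw [tsum_zero] at h1
  have h2 := ((h1.const_mul ((1 + |θ|) * (θ ^ 2 * Real.exp |θ|))).rexp).sub_const 1
  simp only [mul_zero, Real.exp_zero, sub_self] at h2
  exact squeeze_zero (fun _ => norm_nonneg _)
    (fun y => norm_gammaRatio_sub_one_le (hre y) θ) h2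

lemma tendsto_digammaSeries_re {A : ℝ} (hA : 1 ≤ A) :
    Tendsto (fun y : ℝ => (digammaSeries (A + Complex.I * y)).re) atTop atTop := by
  rw [tendsto_atTop]
  intro B
  have hH : Tendsto (fun n : ℕ => ∑ k ∈ range n, 1 / ((k : ℝ) + 1)) atTop atTop :=
    Real.tendsto_sum_range_one_div_nat_succ_atTop
  obtain ⟨N, hN⟩ := (hH.eventually_ge_atTop (B + Real.eulerMascheroniConstant + 1)).exists
  have hterm (y : ℝ) (k : ℕ) : (1 / ((k : ℂ) + 1) - 1 / ((A : ℂ) + Complex.I * y + k)).re =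
      1 / ((k : ℝ) + 1) - (A + k) / ((A + k) ^ 2 + y ^ 2) := by
    have h1 : (1 / ((k : ℂ) + 1)) = ((1 / ((k : ℝ) + 1) : ℝ) : ℂ) := by push_cast; rfl
    rw [Complex.sub_re, h1, Complex.ofReal_re, one_div (_ + _ + _), Complex.inv_re,
      Complex.normSq_apply]
    simp
    ring_nf
  have hle (y : ℝ) (k : ℕ) : 0 ≤ 1 / ((k : ℝ) + 1) - (A + k) / ((A + k) ^ 2 + y ^ 2) := by
    have h0 : 0 < A + k := by positivity
    rw [sub_nonneg, div_le_div_iff₀ (by positivity) (by positivity)]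
    nlinarith [sq_nonneg y, h0]
  have hlim : Tendsto (fun y : ℝ => ∑ k ∈ range N,
      (1 / ((k : ℝ) + 1) - (A + k) / ((A + k) ^ 2 + y ^ 2))) atTop
      (𝓝 (∑ k ∈ range N, (1 / ((k : ℝ) + 1) - 0))) := by
    refine tendsto_finsetSum _ fun k _ => tendsto_const_nhds.sub ?_
    exact tendsto_const_nhds.div_atTop
      (tendsto_atTop_add_const_left _ _ (tendsto_pow_atTop two_ne_zero))
  simp only [sub_zero] at hlim
  filter_upwards [hlim.eventually_const_le
    (show B + Real.eulerMascheroniConstant < ∑ k ∈ range N, 1 / ((k : ℝ) + 1) by linarith)]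
    with y hy
  have hz : 1 ≤ ((A : ℂ) + Complex.I * y).re := by simpa
  have hs := summable_digammaSeries hz
  have hs' := hs.map Complex.reCLM Complex.reCLM.continuous
  have : (digammaSeries (A + Complex.I * y)).re = -Real.eulerMascheroniConstant +
      ∑' k : ℕ, (1 / ((k : ℝ) + 1) - (A + k) / ((A + k) ^ 2 + y ^ 2)) := by
    rw [digammaSeries, Complex.add_re, Complex.re_tsum hs]
    simp only [hterm]
    simp
  rw [this]
  have h3 : ∑ k ∈ range N, (1 / ((k : ℝ) + 1) - (A + k) / ((A + k) ^ 2 + y ^ 2)) ≤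
      ∑' k : ℕ, (1 / ((k : ℝ) + 1) - (A + k) / ((A + k) ^ 2 + y ^ 2)) := by
    refine Summable.sum_le_tsum _ (fun k _ => hle y k) ?_
    refine hs'.congr fun k => ?_
    simpa using hterm y k
  linarith

/-- The theta series `Σ_{n ≥ 1} n^{2k} exp(-πn²x)`. -/
def thetaMoment (k : ℕ) (x : ℝ) : ℝ :=
  ∑' n : ℕ, ((n : ℝ) + 1) ^ (2 * k) * Real.exp (-Real.pi * ((n : ℝ) + 1) ^ 2 * x)

lemma summable_thetaMoment (k : ℕ) {x : ℝ} (hx : 0 < x) :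
    Summable fun n : ℕ =>
      ((n : ℝ) + 1) ^ (2 * k) * Real.exp (-Real.pi * ((n : ℝ) + 1) ^ 2 * x) := by
  have h := (summable_nat_add_iff 1).2
    (Real.summable_pow_mul_exp_neg_nat_mul (2 * k) (mul_pos Real.pi_pos hx))
  refine Summable.of_nonneg_of_le (fun _ => by positivity) (fun n => ?_) h
  push_cast
  refine mul_le_mul_of_nonneg_left (Real.exp_le_exp.2 ?_) (by positivity)
  have h1 : (n : ℝ) + 1 ≤ ((n : ℝ) + 1) ^ 2 := by
    have : (0 : ℝ) ≤ n := n.cast_nonneg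
    nlinarith
  have := mul_le_mul_of_nonneg_left h1 (mul_pos Real.pi_pos hx).le
  linarith

lemma hasDerivAt_thetaMoment (k : ℕ) {x : ℝ} (hx : 0 < x) :
    HasDerivAt (thetaMoment k) (-Real.pi * thetaMoment (k + 1) x) x := by
  have hx2 : 0 < x / 2 := by positivity
  have key := hasDerivAt_tsum_of_isPreconnected (t := Set.Ioi (x / 2)) (y₀ := x) (y := x)
    (g := fun (n : ℕ) y => ((n : ℝ) + 1) ^ (2 * k) * Real.exp (-Real.pi * ((n : ℝ) + 1) ^ 2 * y))
    (g' := fun (n : ℕ) y => -Real.pi *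
      (((n : ℝ) + 1) ^ (2 * (k + 1)) * Real.exp (-Real.pi * ((n : ℝ) + 1) ^ 2 * y)))
    ((summable_thetaMoment (k + 1) hx2).mul_left Real.pi) isOpen_Ioi isPreconnected_Ioi
    (fun n y _ => ?_) (fun n y hy => ?_) (by simpa using hx) (summable_thetaMoment k hx)
    (by simpa using hx)
  · rw [tsum_mul_left] at key
    exact key
  · have h1 := (((hasDerivAt_id y).const_mul (-Real.pi * ((n : ℝ) + 1) ^ 2)).exp).const_mul
      (((n : ℝ) + 1) ^ (2 * k))
    refine h1.congr_deriv ?_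
    simp only [id]
    ring
  · rw [norm_mul, norm_neg, Real.norm_of_nonneg Real.pi_pos.le, Real.norm_of_nonneg (by positivity)]
    have hy' : x / 2 ≤ y := (Set.mem_Ioi.1 hy).le
    refine mul_le_mul_of_nonneg_left (mul_le_mul_of_nonneg_left (Real.exp_le_exp.2 ?_)
      (by positivity)) Real.pi_pos.le
    have := mul_le_mul_of_nonneg_left hy' (show 0 ≤ Real.pi * ((n : ℝ) + 1) ^ 2 by positivity)
    linarith

lemma Phi_eq_thetaMoment (u : ℝ) :
    Phi u = 2 * Real.pi ^ 2 * Real.exp (9 * u) * thetaMoment 2 (Real.exp (4 * u)) -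
      3 * Real.pi * Real.exp (5 * u) * thetaMoment 1 (Real.exp (4 * u)) := by
  have h (k : ℕ) := summable_thetaMoment k (Real.exp_pos (4 * u))
  rw [thetaMoment, thetaMoment, ← tsum_mul_left, ← tsum_mul_left,
    ← Summable.tsum_sub ((h 2).mul_left _) ((h 1).mul_left _), Phi]
  refine tsum_congr fun n => ?_
  ring

lemma tsum_int_exp_eq {x : ℝ} (hx : 0 < x) :
    ∑' n : ℤ, Real.exp (-Real.pi * x * (n : ℝ) ^ 2) = 1 + 2 * thetaMoment 0 x := by
  have h := summable_thetaMoment 0 hx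
  have e1 : (fun n : ℕ => Real.exp (-Real.pi * x * (((n : ℤ) + 1 : ℤ) : ℝ) ^ 2)) =
      fun n : ℕ => ((n : ℝ) + 1) ^ (2 * 0) * Real.exp (-Real.pi * ((n : ℝ) + 1) ^ 2 * x) := by
    funext n; push_cast; ring_nf
  have e2 : (fun n : ℕ => Real.exp (-Real.pi * x * ((-((n : ℤ) + 1) : ℤ) : ℝ) ^ 2)) =
      fun n : ℕ => ((n : ℝ) + 1) ^ (2 * 0) * Real.exp (-Real.pi * ((n : ℝ) + 1) ^ 2 * x) := by
    funext n; push_cast; ring_nf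
  rw [tsum_of_add_one_of_neg_add_one (f := fun n : ℤ => Real.exp (-Real.pi * x * (n : ℝ) ^ 2))
    (by rw [e1]; exact h) (by rw [e2]; exact h), e1, e2, ← thetaMoment]
  simp
  ring

/-- The even function `e^u θ(e^{4u})`. -/
def symmTheta (u : ℝ) : ℝ := Real.exp u * (1 + 2 * thetaMoment 0 (Real.exp (4 * u)))

lemma symmTheta_neg (u : ℝ) : symmTheta (-u) = symmTheta u := by
  have h := Real.tsum_exp_neg_mul_int_sq (Real.exp_pos (4 * u))
  have h1 (n : ℤ) : -Real.pi / Real.exp (4 * u) * (n : ℝ) ^ 2 =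
      -Real.pi * Real.exp (4 * -u) * (n : ℝ) ^ 2 := by
    rw [mul_neg, Real.exp_neg]; ring
  simp only [h1] at h
  rw [tsum_int_exp_eq (Real.exp_pos _), tsum_int_exp_eq (Real.exp_pos _), ← Real.exp_mul] at h
  rw [symmTheta, symmTheta, h, ← mul_assoc, Real.exp_neg]
  have : Real.exp (4 * u * (1 / 2)) = Real.exp u * Real.exp u := by
    rw [← Real.exp_add]; ring_nf
  rw [this]
  field_simp

lemma hasDerivAt_exp_mul_thetaMoment (k : ℕ) (c u : ℝ) :
    HasDerivAt (fun u => Real.exp (c * u) * thetaMoment k (Real.exp (4 * u)))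
      (c * (Real.exp (c * u) * thetaMoment k (Real.exp (4 * u))) -
        4 * Real.pi * (Real.exp ((c + 4) * u) * thetaMoment (k + 1) (Real.exp (4 * u)))) u := by
  have h1 (d : ℝ) : HasDerivAt (fun u => Real.exp (d * u)) (Real.exp (d * u) * d) u := by
    simpa using ((hasDerivAt_id u).const_mul d).exp
  have h2 := (hasDerivAt_thetaMoment k (Real.exp_pos (4 * u))).comp u (h1 4)
  refine ((h1 c).mul h2).congr_deriv ?_
  rw [add_mul, Real.exp_add]
  simp only [Function.comp]
  ring

lemma hasDerivAt_symmTheta (u : ℝ) : HasDerivAt symmTheta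
    (symmTheta u - 8 * Real.pi * (Real.exp (5 * u) * thetaMoment 1 (Real.exp (4 * u)))) u := by
  have h := (Real.hasDerivAt_exp u).add ((hasDerivAt_exp_mul_thetaMoment 0 1 u).const_mul 2)
  refine (h.congr_deriv ?_).congr_of_eventuallyEq (Eventually.of_forall fun v => ?_)
  · rw [symmTheta]
    norm_num
    ring
  · simp only [symmTheta, Pi.add_apply, one_mul]
    ring

lemma deriv_symmTheta : deriv symmTheta =
    fun u => symmTheta u - 8 * Real.pi * (Real.exp (5 * u) * thetaMoment 1 (Real.exp (4 * u))) :=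
  funext fun u => (hasDerivAt_symmTheta u).deriv

lemma deriv_deriv_symmTheta (u : ℝ) :
    deriv (deriv symmTheta) u = symmTheta u + 16 * Phi u := by
  have h := (hasDerivAt_symmTheta u).sub
    ((hasDerivAt_exp_mul_thetaMoment 1 5 u).const_mul (8 * Real.pi))
  have e : HasDerivAt (deriv symmTheta) (symmTheta u + 16 * Phi u) u := by
    rw [deriv_symmTheta]
    refine h.congr_deriv ?_
    rw [Phi_eq_thetaMoment]
    norm_num
    ring
  exact e.deriv

lemma Phi_neg (u : ℝ) : Phi (-u) = Phi u := by
  have h1 (u : ℝ) : deriv symmTheta (-u) = -deriv symmTheta u := by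
    have := deriv_comp_neg symmTheta u
    simp only [symmTheta_neg] at this
    have h2 : deriv (fun x => symmTheta x) u = deriv symmTheta u := rfl
    linarith
  have h2 : deriv (deriv symmTheta) (-u) = deriv (deriv symmTheta) u := by
    have := deriv_comp_neg (deriv symmTheta) u
    simp only [h1] at this
    rw [deriv.fun_neg] at this
    have h2 : deriv (fun x => deriv symmTheta x) u = deriv (deriv symmTheta) u := rfl
    linarith
  rw [deriv_deriv_symmTheta, deriv_deriv_symmTheta, symmTheta_neg] at h2
  linarith

lemma integral_cexp_mul_exp_neg_exp {s : ℂ} (hs : 0 < s.re) :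
    ∫ v : ℝ, Complex.exp (s * v) * (Real.exp (-Real.pi * Real.exp (4 * v)) : ℝ) =
      1 / 4 * (1 / (Real.pi : ℂ)) ^ (s / 4) * Complex.Gamma (s / 4) := by
  have hs4 : 0 < (s / 4).re := by simpa using hs
  have h := Complex.integral_cpow_mul_exp_neg_mul_Ioi (r := (Real.pi : ℝ)) hs4
    (by simpa using Real.pi_pos)
  have himg : (fun v : ℝ => Real.exp (4 * v)) '' Set.univ = Set.Ioi 0 := by
    ext x
    simp only [Set.image_univ, Set.mem_range, Set.mem_Ioi]
    refine ⟨fun ⟨v, hv⟩ => hv ▸ Real.exp_pos _, fun hx => ⟨Real.log x / 4, ?_⟩⟩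
    rw [mul_div_cancel₀ _ (by norm_num), Real.exp_log hx]
  have hinj : Set.univ.InjOn (fun v : ℝ => Real.exp (4 * v)) := fun a _ b _ hab => by
    simpa using hab
  have hder : ∀ v ∈ Set.univ, HasDerivWithinAt (fun v : ℝ => Real.exp (4 * v))
      (Real.exp (4 * v) * 4) Set.univ v := fun v _ =>
    HasDerivAt.hasDerivWithinAt (by simpa using ((hasDerivAt_id v).const_mul 4).exp)
  rw [← himg, integral_image_eq_integral_abs_deriv_smul MeasurableSet.univ hder hinj] at h
  rw [mul_assoc, ← h, setIntegral_univ, ← integral_const_mul]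
  refine integral_congr_ae (Eventually.of_forall fun v => ?_)
  have hl : Complex.log ((Real.exp (4 * v) : ℝ) : ℂ) = 4 * v := by
    rw [← Complex.ofReal_log (Real.exp_pos _).le, Real.log_exp]; push_cast; ring
  have hne : ((Real.exp (4 * v) : ℝ) : ℂ) ≠ 0 := by exact_mod_cast (Real.exp_pos _).ne'
  have hc : ((Real.exp (4 * v) : ℝ) : ℂ) ^ (s / 4 - 1) =
      Complex.exp (s * v) * Complex.exp (-(4 * v)) := by
    rw [Complex.cpow_def_of_ne_zero hne, hl, ← Complex.exp_add]
    congr 1; ring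
  have e2 : Complex.exp (-(4 * v)) * Complex.exp (4 * v) = 1 := by
    rw [← Complex.exp_add]; simp
  simp only [hc, abs_of_pos (show 0 < Real.exp (4 * v) * 4 by positivity), Complex.real_smul]
  push_cast
  rw [neg_mul]
  linear_combination (-Complex.exp (s * v) * Complex.exp (-(Real.pi * Complex.exp (4 * v)))) * e2

lemma integrable_cexp_mul_exp_neg_exp {s : ℂ} (hs : 0 < s.re) :
    Integrable fun v : ℝ =>
      Complex.exp (s * v) * (Real.exp (-Real.pi * Real.exp (4 * v)) : ℝ) := by
  by_contra hcon
  have h := integral_cexp_mul_exp_neg_exp hs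
  rw [integral_undef hcon] at h
  have hG : Complex.Gamma (s / 4) ≠ 0 := Complex.Gamma_ne_zero_of_re_pos (by simpa using hs)
  have hp : (1 / (Real.pi : ℂ)) ^ (s / 4) ≠ 0 := by
    simp [Complex.cpow_eq_zero_iff, Real.pi_ne_zero]
  exact mul_ne_zero (mul_ne_zero (by norm_num) hp) hG h.symm

/-- The first term of the series for `Φ`, multiplied by `e^{2qv}`. -/
def mellinKernel (q : ℂ) (v : ℝ) : ℂ :=
  2 * Real.pi ^ 2 *
      (Complex.exp ((9 + 2 * q) * v) * (Real.exp (-Real.pi * Real.exp (4 * v)) : ℝ)) -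
    3 * Real.pi * (Complex.exp ((5 + 2 * q) * v) * (Real.exp (-Real.pi * Real.exp (4 * v)) : ℝ))

/-- The gamma factor of the xi function, up to the factor `s`. -/
def archFactor (α : ℂ) : ℂ :=
  Real.pi / 4 * (1 / (Real.pi : ℂ)) ^ α * Complex.Gamma α * (2 * α - 3)

lemma integrable_mellinKernel {q : ℂ} (hq : 0 < q.re) : Integrable (mellinKernel q) :=
  ((integrable_cexp_mul_exp_neg_exp (by simp; linarith)).const_mul _).sub
    ((integrable_cexp_mul_exp_neg_exp (by simp; linarith)).const_mul _)

lemma integral_mellinKernel {q : ℂ} (hq : 0 < q.re) :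
    ∫ v, mellinKernel q v = archFactor ((5 + 2 * q) / 4) := by
  have h9 : 0 < (9 + 2 * q).re := by simp; linarith
  have h5 : 0 < (5 + 2 * q).re := by simp; linarith
  have hne : (5 + 2 * q) / 4 ≠ 0 := fun h => by
    have : (5 + 2 * q) = 0 := by simpa using h
    rw [this] at h5; simp at h5
  have hpi : (Real.pi : ℂ) ≠ 0 := by exact_mod_cast Real.pi_ne_zero
  simp only [mellinKernel]
  rw [integral_sub ((integrable_cexp_mul_exp_neg_exp h9).const_mul _)
    ((integrable_cexp_mul_exp_neg_exp h5).const_mul _), integral_const_mul, integral_const_mul,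
    integral_cexp_mul_exp_neg_exp h9, integral_cexp_mul_exp_neg_exp h5,
    show (9 + 2 * q) / 4 = (5 + 2 * q) / 4 + 1 by ring, Complex.Gamma_add_one _ hne,
    Complex.cpow_add _ _ (by simp), Complex.cpow_one, archFactor]
  field_simp

lemma continuous_Phi : Continuous Phi := by
  have h (k : ℕ) : Continuous fun u : ℝ => thetaMoment k (Real.exp (4 * u)) :=
    continuous_iff_continuousAt.2 fun u =>
      ContinuousAt.comp (f := fun u : ℝ => Real.exp (4 * u))
        (hasDerivAt_thetaMoment k (Real.exp_pos (4 * u))).continuousAt (by fun_prop)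
  have h2 := h 2
  have h1 := h 1
  rw [show Phi = _ from funext Phi_eq_thetaMoment]
  fun_prop

lemma Phi_mul_cexp_eq_tsum (q : ℂ) (u : ℝ) :
    HasSum (fun n : ℕ => Complex.exp (-(q + 1 / 2) * Real.log (n + 1)) *
      mellinKernel q (u + Real.log (n + 1) / 2)) ((Phi u : ℂ) * Complex.exp (2 * q * u)) := by
  have hk (k : ℕ) := (summable_thetaMoment k (Real.exp_pos (4 * u))).hasSum
  have h := ((hk 2).mul_left (2 * Real.pi ^ 2 * Real.exp (9 * u))).sub
    ((hk 1).mul_left (3 * Real.pi * Real.exp (5 * u)))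
  rw [← thetaMoment, ← thetaMoment, ← Phi_eq_thetaMoment] at h
  have h2 := (Complex.hasSum_ofReal.2 h).mul_right (Complex.exp (2 * q * u))
  refine (congrArg (fun F : ℕ → ℂ => HasSum F _) (funext fun n => ?_)).mpr h2
  set L := Real.log ((n : ℝ) + 1) with hL
  have hpos : (0 : ℝ) < (n : ℝ) + 1 := by positivity
  have hn : (n : ℝ) + 1 = Real.exp L := (Real.exp_log hpos).symm
  rw [hn]
  have e1 : 4 * (u + L / 2) = L * 2 + 4 * u := by ring
  have e2 : Real.exp L ^ 2 = Real.exp (L * 2) := by rw [← Real.exp_nat_mul]; ring_nf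
  have e4 (m : ℕ) : Real.exp L ^ m = Real.exp (m * L) := by rw [← Real.exp_nat_mul]
  rw [mellinKernel, e1, e2, mul_assoc (-Real.pi), ← Real.exp_add, e4]
  push_cast
  have a9 : Complex.exp (-(q + 1 / 2) * L) * Complex.exp ((9 + 2 * q) * (u + L / 2)) =
      Complex.exp (9 * u) * Complex.exp (4 * L) * Complex.exp (2 * q * u) := by
    simp only [← Complex.exp_add]; congr 1; ring
  have a5 : Complex.exp (-(q + 1 / 2) * L) * Complex.exp ((5 + 2 * q) * (u + L / 2)) =
      Complex.exp (5 * u) * Complex.exp (L * 2) * Complex.exp (2 * q * u) := by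
    simp only [← Complex.exp_add]; congr 1; ring
  generalize Complex.exp (-(q + 1 / 2) * L) = w at a5 a9 ⊢
  norm_num
  linear_combination (2 * Real.pi ^ 2 * Complex.exp (-(Real.pi * Complex.exp (L * 2 + 4 * u)))) * a9
    - (3 * Real.pi * Complex.exp (-(Real.pi * Complex.exp (L * 2 + 4 * u)))) * a5

lemma integrable_of_hasSum {f : ℝ → ℂ} {F : ℕ → ℝ → ℂ} (hf : Continuous f)
    (hF : ∀ n, Integrable (F n)) (hs : Summable fun n => ∫ u, ‖F n u‖)
    (h : ∀ u, HasSum (fun n => F n u) (f u)) : Integrable f := by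
  refine ⟨hf.aestronglyMeasurable, ?_⟩
  have h1 : ∫⁻ u, ‖f u‖ₑ ≤ ∑' n, ∫⁻ u, ‖F n u‖ₑ := by
    rw [← lintegral_tsum fun n => (hF n).1.enorm]
    refine lintegral_mono fun u => ?_
    rw [← (h u).tsum_eq]
    exact enorm_tsum_le_tsum_enorm
  refine lt_of_le_of_lt h1 ?_
  have h2 (n : ℕ) : ∫⁻ u, ‖F n u‖ₑ = ENNReal.ofReal (∫ u, ‖F n u‖) :=
    (ofReal_integral_norm_eq_lintegral_enorm (hF n)).symm
  simp only [h2]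
  rw [← ENNReal.ofReal_tsum_of_nonneg (fun n => integral_nonneg fun _ => norm_nonneg _) hs]
  exact ENNReal.ofReal_lt_top

lemma norm_dirichlet_term (s : ℂ) (n : ℕ) :
    ‖Complex.exp (-s * Real.log (n + 1))‖ = ((n : ℝ) + 1) ^ (-s.re) := by
  rw [Complex.norm_exp, Real.rpow_def_of_pos (by positivity)]
  simp only [Complex.mul_re, Complex.neg_re, Complex.ofReal_re, Complex.ofReal_im]
  ring_nf

lemma summable_rpow_neg {c : ℝ} (hc : 1 < c) : Summable fun n : ℕ => ((n : ℝ) + 1) ^ (-c) := by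
  have := (summable_nat_add_iff 1).2 (Real.summable_nat_rpow.2 (by linarith : -c < -1))
  simpa using this

/-- The Dirichlet series `Σ n^{-s}`. -/
def zetaSeries (s : ℂ) : ℂ := ∑' n : ℕ, Complex.exp (-s * Real.log (n + 1))

lemma mellin_Phi {q : ℂ} (hq : 1 / 2 < q.re) :
    Integrable (fun u : ℝ => (Phi u : ℂ) * Complex.exp (2 * q * u)) ∧
    ∫ u : ℝ, (Phi u : ℂ) * Complex.exp (2 * q * u) =
      zetaSeries (q + 1 / 2) * archFactor ((5 + 2 * q) / 4) := by
  have h_int := integrable_mellinKernel (by linarith : 0 < q.re)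
  set F : ℕ → ℝ → ℂ := fun n u => Complex.exp (-(q + 1 / 2) * Real.log (n + 1)) *
      mellinKernel q (u + Real.log (n + 1) / 2) with hFdef
  have hF (n : ℕ) : Integrable (F n) := (h_int.comp_add_right (Real.log (n + 1) / 2)).const_mul _
  have hn (n : ℕ) : ∫ u, ‖F n u‖ = ((n : ℝ) + 1) ^ (-(q + 1 / 2).re) *
      ∫ v, ‖mellinKernel q v‖ := by
    simp only [hFdef, norm_mul, norm_dirichlet_term]
    rw [integral_const_mul,
      integral_add_right_eq_self (fun u => ‖mellinKernel q u‖) (Real.log (n + 1) / 2)]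
  have hs : Summable fun n => ∫ u, ‖F n u‖ := by
    simp only [hn]
    exact (summable_rpow_neg (by simp; linarith)).mul_right _
  have hsum := Phi_mul_cexp_eq_tsum q
  have hc : Continuous (fun u : ℝ => (Phi u : ℂ) * Complex.exp (2 * q * u)) := by
    have := continuous_Phi
    fun_prop
  refine ⟨integrable_of_hasSum hc hF hs hsum, ?_⟩
  have h := hasSum_integral_of_summable_integral_norm hF hs
  have e (u : ℝ) : ∑' n, F n u = (Phi u : ℂ) * Complex.exp (2 * q * u) := (hsum u).tsum_eq
  have e2 (n : ℕ) : ∫ u, F n u = Complex.exp (-(q + 1 / 2) * Real.log (n + 1)) *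
      archFactor ((5 + 2 * q) / 4) := by
    simp only [hFdef]
    rw [integral_const_mul, integral_add_right_eq_self (mellinKernel q) (Real.log (n + 1) / 2),
      integral_mellinKernel (by linarith)]
  simp only [e, e2] at h
  rw [← h.tsum_eq, tsum_mul_right, zetaSeries]

/-- The Gaussian `e^{-a(τ+iP)²}`. -/
def shiftedGaussian (a : ℝ) (P : ℂ) (τ : ℝ) : ℂ := Complex.exp (-a * (τ + Complex.I * P) ^ 2)

lemma shiftedGaussian_mul_cexp (a : ℝ) (P c : ℂ) (τ : ℝ) :
    Complex.exp (c * τ) * shiftedGaussian a P τ =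
      Complex.exp (-a * τ ^ 2 + (c - 2 * a * Complex.I * P) * τ + a * P ^ 2) := by
  rw [shiftedGaussian, ← Complex.exp_add]
  congr 1
  linear_combination (-a * P ^ 2) * Complex.I_sq

lemma integrable_shiftedGaussian {a : ℝ} (ha : 0 < a) (P : ℂ) :
    Integrable (shiftedGaussian a P) := by
  have h := integrable_cexp_quadratic' (b := -a) (by simpa using ha)
    (0 - 2 * a * Complex.I * P) (a * P ^ 2)
  refine h.congr (Eventually.of_forall fun τ => ?_)
  simpa using (shiftedGaussian_mul_cexp a P 0 τ).symm

lemma integral_cexp_mul_shiftedGaussian {a : ℝ} (ha : 0 < a) (P c : ℂ) :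
    ∫ τ : ℝ, Complex.exp (c * τ) * shiftedGaussian a P τ =
      (Real.pi / a : ℂ) ^ (1 / 2 : ℂ) * Complex.exp (c ^ 2 / (4 * a) - Complex.I * c * P) := by
  simp only [shiftedGaussian_mul_cexp]
  have ha' : (a : ℂ) ≠ 0 := by exact_mod_cast ha.ne'
  rw [integral_cexp_quadratic (by simpa using ha), neg_neg]
  congr 2
  field_simp
  linear_combination (4 * P ^ 2 * a ^ 2) * Complex.I_sq

lemma gaussian_const_ne_zero {a : ℝ} (ha : 0 < a) : (Real.pi / a : ℂ) ^ (1 / 2 : ℂ) ≠ 0 := by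
  simp [Complex.cpow_eq_zero_iff, Real.pi_ne_zero, ha.ne']

lemma integral_gaussian_swap {a : ℝ} (ha : 0 < a) {γ : ℂ} (hγ : 1 / 2 < γ.re) (P : ℂ) :
    Integrable (fun u : ℝ => Complex.exp (-(u : ℂ) ^ 2 / a + 2 * P * u) *
      ((Phi u : ℂ) * Complex.exp (2 * γ * u))) ∧
    (Real.pi / a : ℂ) ^ (1 / 2 : ℂ) * ∫ u : ℝ, Complex.exp (-(u : ℂ) ^ 2 / a + 2 * P * u) *
      ((Phi u : ℂ) * Complex.exp (2 * γ * u)) =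
    ∫ τ : ℝ, shiftedGaussian a P τ * (zetaSeries (γ + Complex.I * τ + 1 / 2) *
        archFactor ((5 + 2 * (γ + Complex.I * τ)) / 4)) := by
  have ha' : (a : ℂ) ≠ 0 := by exact_mod_cast ha.ne'
  have hprod : Integrable (Function.uncurry fun u τ : ℝ => Complex.exp (2 * Complex.I * u * τ) *
      ((Phi u : ℂ) * Complex.exp (2 * γ * u) * shiftedGaussian a P τ)) (volume.prod volume) := by
    refine ((mellin_Phi hγ).1.mul_prod (integrable_shiftedGaussian ha P)).bdd_mul (c := 1)
      (by apply Continuous.aestronglyMeasurable; fun_prop) (Eventually.of_forall fun x => ?_)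
    rw [Complex.norm_exp]
    simp
  have hinner (u : ℝ) : ∫ τ : ℝ, Complex.exp (2 * Complex.I * u * τ) *
      ((Phi u : ℂ) * Complex.exp (2 * γ * u) * shiftedGaussian a P τ) =
      (Real.pi / a : ℂ) ^ (1 / 2 : ℂ) * (Complex.exp (-(u : ℂ) ^ 2 / a + 2 * P * u) *
      ((Phi u : ℂ) * Complex.exp (2 * γ * u))) := by
    simp only [mul_left_comm _ ((Phi u : ℂ) * Complex.exp (2 * γ * u)) _]
    rw [integral_const_mul, integral_cexp_mul_shiftedGaussian ha]
    have : (2 * Complex.I * u) ^ 2 / (4 * a) - Complex.I * (2 * Complex.I * u) * P =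
        -(u : ℂ) ^ 2 / a + 2 * P * u := by
      field_simp
      linear_combination (4 * u ^ 2 - 8 * a * u * P) * Complex.I_sq
    rw [this]
    ring
  have h_int := hprod.integral_prod_left
  simp only [Function.uncurry, hinner] at h_int
  refine ⟨?_, ?_⟩
  · refine (h_int.const_mul ((Real.pi / a : ℂ) ^ (1 / 2 : ℂ))⁻¹).congr
      (Eventually.of_forall fun u => ?_)
    exact inv_mul_cancel_left₀ (gaussian_const_ne_zero ha) _
  · rw [← integral_const_mul]
    simp only [← hinner]
    rw [integral_integral_swap hprod]
    refine integral_congr_ae (Eventually.of_forall fun τ => ?_)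
    have hq : 1 / 2 < (γ + Complex.I * τ).re := by simpa using hγ
    simp only
    rw [← (mellin_Phi hq).2, ← integral_const_mul]
    refine integral_congr_ae (Eventually.of_forall fun u => ?_)
    have : Complex.exp (2 * (γ + Complex.I * τ) * u) =
        Complex.exp (2 * Complex.I * u * τ) * Complex.exp (2 * γ * u) := by
      rw [← Complex.exp_add]; congr 1; ring
    simp only [this]
    ring

lemma H_eq_integral {a : ℝ} (ha : 0 < a) {γ : ℂ} (hγ : 1 / 2 < γ.re) (P : ℂ) :
    2 * (Real.pi / a : ℂ) ^ (1 / 2 : ℂ) * H (-(1 / a)) (-2 * Complex.I * (γ + P)) =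
    ∫ τ : ℝ, shiftedGaussian a P τ * (zetaSeries (γ + Complex.I * τ + 1 / 2) *
        archFactor ((5 + 2 * (γ + Complex.I * τ)) / 4)) := by
  obtain ⟨h_int, h⟩ := integral_gaussian_swap ha hγ P
  rw [← h, mul_comm (2 : ℂ), mul_assoc]
  congr 1
  set f : ℝ → ℂ := fun u => Complex.exp (-(u : ℂ) ^ 2 / a + 2 * P * u) *
      ((Phi u : ℂ) * Complex.exp (2 * γ * u)) with hf
  have hn : Integrable fun u => f (-u) := h_int.comp_neg
  have e := integral_comp_neg_Ioi 0 f
  rw [neg_zero] at e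
  rw [← intervalIntegral.integral_Iic_add_Ioi (b := 0) h_int.integrableOn h_int.integrableOn, ← e,
    ← integral_add hn.integrableOn h_int.integrableOn, H, ← integral_const_mul]
  refine integral_congr_ae (Eventually.of_forall fun u => ?_)
  have e1 : (u : ℂ) * (-2 * Complex.I * (γ + P)) * Complex.I = 2 * γ * u + 2 * P * u := by
    linear_combination (-2 * u * (γ + P)) * Complex.I_sq
  have e1' : -((u : ℂ) * (-2 * Complex.I * (γ + P))) * Complex.I = -(2 * γ * u) + -(2 * P * u) := by
    linear_combination -e1
  have e2 : -(1 / (a : ℂ)) * u ^ 2 = -(u : ℂ) ^ 2 / a := by ring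
  simp only [hf, Phi_neg, Complex.cos, e1, e1']
  push_cast
  simp only [neg_sq, mul_neg, Complex.exp_add, e2]
  ring

lemma norm_shiftedGaussian (a : ℝ) (P : ℂ) (τ : ℝ) :
    ‖shiftedGaussian a P τ‖ = Real.exp (-a * (τ - P.im) ^ 2 + a * P.re ^ 2) := by
  rw [shiftedGaussian, Complex.norm_exp]
  congr 1
  simp [pow_two]
  ring

/-- Half the difference of the digamma series and `log π`, the approximate logarithmic derivative
of `archFactor` along vertical lines. -/
def archSlope (α : ℂ) : ℂ := (digammaSeries α - Real.log Real.pi) / 2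

/-- The quotient of `archFactor (α + iτ/2)` by its first-order approximation. -/
def archRatio (α : ℂ) (τ : ℝ) : ℂ :=
  gammaRatio α (τ / 2) * ((2 * α - 3 + Complex.I * τ) / (2 * α - 3))

lemma two_mul_sub_three_ne_zero {α : ℂ} (hα : 3 / 2 < α.re) : 2 * α - 3 ≠ 0 := fun h => by
  have := congrArg Complex.re h
  simp at this
  linarith

lemma archFactor_add {α : ℂ} (hα : 3 / 2 < α.re) (τ : ℝ) :
    archFactor (α + Complex.I * (τ / 2)) =
      archFactor α * Complex.exp (Complex.I * archSlope α * τ) * archRatio α τ := by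
  have h1 := two_mul_sub_three_ne_zero hα
  have h2 : Complex.Gamma α ≠ 0 := Complex.Gamma_ne_zero_of_re_pos (by linarith)
  have hpi : (1 / (Real.pi : ℂ)) ≠ 0 := by simp [Real.pi_ne_zero]
  have hlog : Complex.log (1 / (Real.pi : ℂ)) = -Real.log Real.pi := by
    rw [one_div, ← Complex.ofReal_inv, ← Complex.ofReal_log (by positivity), Real.log_inv]
    simp
  have e : Complex.exp (Complex.I * archSlope α * τ) *
      Complex.exp (-(Complex.I * ((τ / 2 : ℝ) : ℂ) * digammaSeries α)) =
      Complex.exp (-Real.log Real.pi * (Complex.I * (τ / 2))) := by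
    rw [← Complex.exp_add, archSlope]
    congr 1
    push_cast
    ring
  rw [archRatio, gammaRatio, archFactor, archFactor, Complex.cpow_add _ _ hpi,
    Complex.cpow_def_of_ne_zero hpi (Complex.I * (τ / 2)), hlog, ← e]
  push_cast
  field_simp
  ring

lemma shiftedGaussian_add_mul_cexp {a : ℝ} (ha : 0 < a) (p κ : ℂ) (τ : ℝ) :
    shiftedGaussian a (p + κ / (2 * a)) τ * Complex.exp (Complex.I * κ * τ) =
      Complex.exp (κ * p + κ ^ 2 / (4 * a)) * shiftedGaussian a p τ := by
  have ha' : (a : ℂ) ≠ 0 := by exact_mod_cast ha.ne'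
  rw [shiftedGaussian, shiftedGaussian, ← Complex.exp_add, ← Complex.exp_add]
  congr 1
  field_simp
  linear_combination (-16 * a * p * κ - 4 * κ ^ 2) * Complex.I_sq

/-- The Gaussian transform of `f`. -/
def gaussTransform (a : ℝ) (f : ℝ → ℂ) (p : ℂ) : ℂ := ∫ τ : ℝ, shiftedGaussian a p τ * f τ

lemma H_eq_gaussTransform {a x T : ℝ} (ha : 0 < a) (hx : 1 / 2 < x) (p : ℂ) {α : ℂ}
    (hα : α = ((5 / 4 + x / 2 : ℝ) : ℂ) + Complex.I * ((T / 2 : ℝ) : ℂ)) :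
    2 * (Real.pi / a : ℂ) ^ (1 / 2 : ℂ) *
      H (-(1 / a)) (-2 * Complex.I * (x + Complex.I * T + (p + archSlope α / (2 * a)))) =
    archFactor α * Complex.exp (archSlope α * p + archSlope α ^ 2 / (4 * a)) *
      gaussTransform a (fun τ => archRatio α τ *
        zetaSeries ((x + 1 / 2 : ℝ) + Complex.I * (T + τ))) p := by
  have hre : 3 / 2 < α.re := by simp [hα]; linarith
  rw [H_eq_integral ha (by simpa using hx), gaussTransform, ← integral_const_mul]
  refine integral_congr_ae (Eventually.of_forall fun τ => ?_)
  have e1 : (5 + 2 * ((x : ℂ) + Complex.I * T + Complex.I * τ)) / 4 =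
      α + Complex.I * (τ / 2) := by
    rw [hα]; push_cast; ring
  have e2 : (x : ℂ) + Complex.I * T + Complex.I * τ + 1 / 2 =
      (x + 1 / 2 : ℝ) + Complex.I * (T + τ) := by push_cast; ring
  simp only [e1, e2, archFactor_add hre]
  linear_combination (zetaSeries ((x + 1 / 2 : ℝ) + Complex.I * (T + τ)) * archFactor α *
    archRatio α τ) * shiftedGaussian_add_mul_cexp ha p (archSlope α) τ

lemma one_add_abs_le {a : ℝ} (ha : 0 < a) (τ : ℝ) :
    1 + |τ| ≤ (2 + 8 / a) * Real.exp (a / 16 * τ ^ 2) := by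
  have h1 := Real.add_one_le_exp (a / 16 * τ ^ 2)
  have h2 : (2 + 8 / a) * (a / 16 * τ ^ 2 + 1) ≤ (2 + 8 / a) * Real.exp (a / 16 * τ ^ 2) :=
    mul_le_mul_of_nonneg_left h1 (by positivity)
  refine le_trans ?_ h2
  have h3 : (2 + 8 / a) * (a / 16 * τ ^ 2 + 1) = a / 8 * τ ^ 2 + 2 + τ ^ 2 / 2 + 8 / a := by
    field_simp; ring
  have h4 : 0 ≤ 8 / a := by positivity
  have h5 : 0 ≤ a / 8 * τ ^ 2 := by positivity
  rw [h3]
  nlinarith [sq_nonneg (|τ| - 1), sq_abs τ]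

lemma norm_shiftedGaussian_le {a : ℝ} (ha : 0 < a) {p : ℂ} {ρ : ℝ} (hp : ‖p‖ ≤ ρ) (τ : ℝ) :
    ‖shiftedGaussian a p τ‖ ≤ Real.exp (4 * a * ρ ^ 2) * Real.exp (-(3 / 4 * a) * τ ^ 2) := by
  rw [norm_shiftedGaussian, ← Real.exp_add]
  refine Real.exp_le_exp.2 ?_
  have h1 : p.re ^ 2 ≤ ρ ^ 2 := sq_le_sq' (by linarith [neg_abs_le p.re, Complex.abs_re_le_norm p])
    ((le_abs_self _).trans ((Complex.abs_re_le_norm p).trans hp))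
  have h2 : p.im ^ 2 ≤ ρ ^ 2 := sq_le_sq' (by linarith [neg_abs_le p.im, Complex.abs_im_le_norm p])
    ((le_abs_self _).trans ((Complex.abs_im_le_norm p).trans hp))
  nlinarith [mul_nonneg ha.le (sq_nonneg (τ / 2 - 2 * p.im)),
    mul_le_mul_of_nonneg_left h1 ha.le, mul_le_mul_of_nonneg_left h2 ha.le]

lemma hasDerivAt_shiftedGaussian (a : ℝ) (p : ℂ) (τ : ℝ) :
    HasDerivAt (fun p => shiftedGaussian a p τ)
      (-2 * a * Complex.I * (τ + Complex.I * p) * shiftedGaussian a p τ) p := by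
  have h := (((((hasDerivAt_id p).const_mul Complex.I).const_add (τ : ℂ)).pow 2).const_mul
    (-a : ℂ)).cexp
  refine h.congr_deriv ?_
  simp [shiftedGaussian]
  ring

lemma differentiable_gaussTransform {a B : ℝ} (ha : 0 < a) {f : ℝ → ℂ} (hf : Continuous f)
    (hB : ∀ τ, ‖f τ‖ ≤ B * Real.exp (9 / 16 * a * τ ^ 2)) :
    Differentiable ℂ (gaussTransform a f) := by
  intro p₀
  have hB0 : 0 ≤ B := by have := (norm_nonneg _).trans (hB 0); simpa using this
  set ρ : ℝ := ‖p₀‖ + 1 with hρ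
  have hmeas (p : ℂ) : AEStronglyMeasurable (fun τ => shiftedGaussian a p τ * f τ) volume := by
    apply Continuous.aestronglyMeasurable
    unfold shiftedGaussian
    fun_prop
  have hbd (p : ℂ) (hp : ‖p‖ ≤ ρ) (τ : ℝ) : ‖shiftedGaussian a p τ * f τ‖ ≤
      Real.exp (4 * a * ρ ^ 2) * B * Real.exp (-(3 / 16 * a) * τ ^ 2) := by
    rw [norm_mul]
    refine (mul_le_mul (norm_shiftedGaussian_le ha hp τ) (hB τ) (norm_nonneg _)
      (by positivity)).trans (le_of_eq ?_)
    rw [show -(3 / 16 * a) * τ ^ 2 = -(3 / 4 * a) * τ ^ 2 + 9 / 16 * a * τ ^ 2 by ring,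
      Real.exp_add]
    ring
  have hp₀ : ‖p₀‖ ≤ ρ := by linarith
  have key := hasDerivAt_integral_of_dominated_loc_of_deriv_le (μ := volume) (𝕜 := ℂ)
    (F := fun p τ => shiftedGaussian a p τ * f τ)
    (F' := fun p τ => -2 * a * Complex.I * (τ + Complex.I * p) * shiftedGaussian a p τ * f τ)
    (x₀ := p₀) (s := Metric.ball p₀ 1)
    (bound := fun τ => 2 * a * (1 + ρ) * (2 + 8 / a) * (Real.exp (4 * a * ρ ^ 2) * B) *
      Real.exp (-(1 / 8 * a) * τ ^ 2))
    (Metric.ball_mem_nhds p₀ one_pos) (Eventually.of_forall hmeas)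
    (Integrable.mono' ((integrable_exp_neg_mul_sq (by positivity)).const_mul _) (hmeas p₀)
      (Eventually.of_forall (hbd p₀ hp₀)))
    (by
      apply Continuous.aestronglyMeasurable
      unfold shiftedGaussian
      fun_prop)
    (Eventually.of_forall fun τ p hp => ?_)
    ((integrable_exp_neg_mul_sq (by positivity)).const_mul _)
    (Eventually.of_forall fun τ p _ => (hasDerivAt_shiftedGaussian a p τ).mul_const (f τ))
  · exact key.2.differentiableAt
  · have hp' : ‖p‖ ≤ ρ := by
      have := norm_sub_norm_le p p₀
      rw [Metric.mem_ball, dist_eq_norm] at hp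
      linarith
    have hρ0 : 0 ≤ ρ := (norm_nonneg p).trans hp'
    have h1 : ‖-2 * a * Complex.I * (τ + Complex.I * p)‖ ≤
        2 * a * (1 + ρ) * ((2 + 8 / a) * Real.exp (a / 16 * τ ^ 2)) := by
      have e : ‖(-2 * a * Complex.I : ℂ)‖ = 2 * a := by simp [abs_of_pos ha]
      have h2 : ‖(τ : ℂ) + Complex.I * p‖ ≤ |τ| + ρ :=
        (norm_add_le _ _).trans (by simpa using hp')
      rw [norm_mul, e, mul_assoc (2 * a)]
      refine mul_le_mul_of_nonneg_left (h2.trans ?_) (by positivity)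
      refine le_trans ?_ (mul_le_mul_of_nonneg_left (one_add_abs_le ha τ) (by positivity))
      nlinarith [abs_nonneg τ, mul_nonneg hρ0 (abs_nonneg τ)]
    simp only [mul_assoc _ (shiftedGaussian a p τ) (f τ)]
    rw [norm_mul]
    refine (mul_le_mul h1 (hbd p hp' τ) (norm_nonneg _) (by positivity)).trans (le_of_eq ?_)
    rw [show -(1 / 8 * a) * τ ^ 2 = a / 16 * τ ^ 2 + -(3 / 16 * a) * τ ^ 2 by ring, Real.exp_add]
    ring

lemma continuous_gammaRatio {z : ℂ} (hz : 0 < z.re) : Continuous (gammaRatio z) := by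
  have h : Continuous fun θ : ℝ => Complex.Gamma (z + Complex.I * θ) :=
    continuous_iff_continuousAt.2 fun θ => by
      have h1 : DifferentiableAt ℂ Complex.Gamma (z + Complex.I * θ) :=
        Complex.differentiableAt_Gamma _ fun m hm => by
          have := congrArg Complex.re hm
          simp at this
          have h0 : (0 : ℝ) ≤ m := m.cast_nonneg
          linarith
      exact ContinuousAt.comp (f := fun θ : ℝ => z + Complex.I * θ) h1.continuousAt (by fun_prop)
  unfold gammaRatio
  fun_prop

lemma continuous_archRatio {α : ℂ} (hα : 0 < α.re) : Continuous (archRatio α) := by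
  have := continuous_gammaRatio hα
  unfold archRatio
  fun_prop

lemma norm_archRatio_le {a : ℝ} (ha : 0 < a) {α : ℂ} (h2 : 2 ≤ α.re)
    (hα : 3 / 4 / a + 1 ≤ α.re) (τ : ℝ) :
    ‖archRatio α τ‖ ≤ (2 + 8 / a) * Real.exp (9 / 16 * a * τ ^ 2) := by
  have h3 : 1 ≤ ‖2 * α - 3‖ := by
    have := Complex.re_le_norm (2 * α - 3)
    simp at this
    linarith
  have hne : 2 * α - 3 ≠ 0 := two_mul_sub_three_ne_zero (by linarith)
  have h4 : ‖(2 * α - 3 + Complex.I * τ) / (2 * α - 3)‖ ≤ 1 + |τ| := by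
    rw [add_div, div_self hne]
    refine (norm_add_le _ _).trans ?_
    simp only [norm_one, norm_div, norm_mul, Complex.norm_I, one_mul, Complex.norm_real,
      Real.norm_eq_abs]
    linarith [div_le_self (abs_nonneg τ) h3]
  have h5 : ‖gammaRatio α (τ / 2)‖ ≤ Real.exp (a / 2 * τ ^ 2) := by
    refine (norm_gammaRatio_le (by linarith) _).trans (Real.exp_le_exp.2 ?_)
    have h6 : 1 / (α.re - 1) ≤ a * (4 / 3) := by
      rw [div_le_iff₀ (by linarith)]
      have : a * (4 / 3) * (3 / 4 / a) = 1 := by field_simp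
      nlinarith [mul_le_mul_of_nonneg_left (by linarith : 3 / 4 / a ≤ α.re - 1)
        (by positivity : 0 ≤ a * (4 / 3))]
    have h7 : 3 / 2 * (τ / 2) ^ 2 * (1 / (α.re - 1)) ≤ 3 / 2 * (τ / 2) ^ 2 * (a * (4 / 3)) :=
      mul_le_mul_of_nonneg_left h6 (by positivity)
    linarith
  rw [archRatio, norm_mul]
  refine (mul_le_mul h5 (h4.trans (one_add_abs_le ha τ)) (norm_nonneg _)
    (Real.exp_pos _).le).trans (le_of_eq ?_)
  rw [show 9 / 16 * a * τ ^ 2 = a / 2 * τ ^ 2 + a / 16 * τ ^ 2 by ring, Real.exp_add]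
  ring

lemma tendsto_archRatio {A : ℝ} (hA : 1 ≤ A) (τ : ℝ) :
    Tendsto (fun T : ℝ => archRatio (A + Complex.I * ((T / 2 : ℝ) : ℂ)) τ) atTop (𝓝 1) := by
  have h1 := (tendsto_gammaRatio hA (τ / 2)).comp
    (tendsto_id.atTop_div_const (by norm_num : (0 : ℝ) < 2))
  have h0 : Tendsto (fun T : ℝ =>
      Complex.I * τ / (2 * ((A : ℂ) + Complex.I * ((T / 2 : ℝ) : ℂ)) - 3)) atTop (𝓝 0) := by
    rw [tendsto_zero_iff_norm_tendsto_zero]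
    refine squeeze_zero' (Eventually.of_forall fun _ => norm_nonneg _)
      (g := fun T : ℝ => |τ| / T) ?_ (tendsto_id.const_div_atTop _)
    filter_upwards [eventually_gt_atTop 0] with T hT
    have h3 : T ≤ ‖2 * ((A : ℂ) + Complex.I * ((T / 2 : ℝ) : ℂ)) - 3‖ := by
      refine le_trans (le_of_eq ?_) (Complex.im_le_norm _)
      simp
      ring
    rw [norm_div, norm_mul, Complex.norm_I, one_mul, Complex.norm_real, Real.norm_eq_abs]
    exact div_le_div_of_nonneg_left (abs_nonneg _) hT h3
  have h2 : Tendsto (fun T : ℝ => (2 * ((A : ℂ) + Complex.I * ((T / 2 : ℝ) : ℂ)) - 3 +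
      Complex.I * τ) / (2 * ((A : ℂ) + Complex.I * ((T / 2 : ℝ) : ℂ)) - 3)) atTop (𝓝 1) := by
    have h := h0.const_add 1
    rw [add_zero] at h
    refine h.congr' ?_
    filter_upwards [eventually_gt_atTop 0] with T hT
    have hne : 2 * ((A : ℂ) + Complex.I * ((T / 2 : ℝ) : ℂ)) - 3 ≠ 0 := fun h => by
      have := congrArg Complex.im h
      simp at this
      linarith
    rw [add_div, div_self hne]
  simpa [archRatio] using h1.mul h2

lemma norm_zetaSeries_le {s : ℂ} {c : ℝ} (hc : 1 < c) (hs : s.re = c) :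
    ‖zetaSeries s‖ ≤ ∑' n : ℕ, ((n : ℝ) + 1) ^ (-c) :=
  tsum_of_norm_bounded (summable_rpow_neg hc).hasSum fun n => by rw [norm_dirichlet_term, hs]

lemma continuous_zetaSeries_line {c : ℝ} (hc : 1 < c) (T : ℝ) :
    Continuous fun τ : ℝ => zetaSeries (c + Complex.I * (T + τ)) := by
  unfold zetaSeries
  refine continuous_tsum (u := fun n : ℕ => ((n : ℝ) + 1) ^ (-c)) (fun n => by fun_prop)
    (summable_rpow_neg hc) fun n τ => ?_
  rw [norm_dirichlet_term]
  simp

/-- The Dirichlet series `Σ n^{-w} exp(-(log n)² / (4a))`. -/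
def gaussDirichlet (a : ℝ) (w : ℂ) : ℂ :=
  ∑' n : ℕ, Complex.exp (-w * Real.log (n + 1) - (Real.log (n + 1)) ^ 2 / (4 * a))

lemma gaussTransform_zetaSeries {a c : ℝ} (ha : 0 < a) (hc : 1 < c) (T : ℝ) (p : ℂ) :
    gaussTransform a (fun τ => zetaSeries (c + Complex.I * (T + τ))) p =
      (Real.pi / a : ℂ) ^ (1 / 2 : ℂ) * gaussDirichlet a (c + Complex.I * T + p) := by
  set F : ℕ → ℝ → ℂ := fun n τ => shiftedGaussian a p τ *
    Complex.exp (-(c + Complex.I * (T + τ)) * Real.log (n + 1)) with hF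
  have hE (n : ℕ) (τ : ℝ) : F n τ = Complex.exp (-(c + Complex.I * T) * Real.log (n + 1)) *
      (Complex.exp (-Complex.I * Real.log (n + 1) * τ) * shiftedGaussian a p τ) := by
    rw [hF, ← mul_assoc, ← Complex.exp_add, mul_comm]
    ring_nf
  have hnorm (n : ℕ) (τ : ℝ) : ‖F n τ‖ = ((n : ℝ) + 1) ^ (-c) * ‖shiftedGaussian a p τ‖ := by
    simp only [hF]
    rw [norm_mul, norm_dirichlet_term, mul_comm]
    simp
  have h_int (n : ℕ) : Integrable (F n) := by
    refine Integrable.mul_bdd (c := ((n : ℝ) + 1) ^ (-c)) (integrable_shiftedGaussian ha p)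
      (by apply Continuous.aestronglyMeasurable; fun_prop) (Eventually.of_forall fun τ => ?_)
    rw [norm_dirichlet_term]
    simp
  have hs : Summable fun n => ∫ τ, ‖F n τ‖ := by
    simp only [hnorm, integral_const_mul]
    exact (summable_rpow_neg hc).mul_right _
  have h := (hasSum_integral_of_summable_integral_norm h_int hs).tsum_eq
  have h1 (τ : ℝ) : ∑' n, F n τ = shiftedGaussian a p τ * zetaSeries (c + Complex.I * (T + τ)) := by
    rw [zetaSeries, ← tsum_mul_left]
  simp only [h1] at h
  rw [gaussTransform, ← h, gaussDirichlet, ← tsum_mul_left]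
  refine tsum_congr fun n => ?_
  simp only [hE]
  rw [integral_const_mul, integral_cexp_mul_shiftedGaussian ha, mul_left_comm, ← Complex.exp_add]
  congr 2
  linear_combination (Real.log (n + 1) ^ 2 / (4 * a) + Real.log (n + 1) * p) * Complex.I_sq

lemma exists_uniform_gaussTransform_approx {a x : ℝ} (ha : 0 < a) (hx : 2 ≤ x)
    (hxa : 3 / 2 / a ≤ x) (ρ : ℝ) :
    ∃ δ : ℝ → ℝ, Tendsto δ atTop (𝓝 0) ∧ ∀ T : ℝ, ∀ p : ℂ, ‖p‖ ≤ ρ →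
      ‖gaussTransform a (fun τ =>
          archRatio (((5 / 4 + x / 2 : ℝ) : ℂ) + Complex.I * ((T / 2 : ℝ) : ℂ)) τ *
            zetaSeries ((x + 1 / 2 : ℝ) + Complex.I * (T + τ))) p -
        (Real.pi / a : ℂ) ^ (1 / 2 : ℂ) *
          gaussDirichlet a ((x + 1 / 2 : ℝ) + Complex.I * T + p)‖ ≤ δ T := by
  set A : ℝ := 5 / 4 + x / 2 with hA
  set α : ℝ → ℂ := fun T => (A : ℂ) + Complex.I * ((T / 2 : ℝ) : ℂ) with hα
  have hre (T : ℝ) : (α T).re = A := by simp [hα]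
  have hA2 : 2 ≤ A := by linarith
  have hAa : 3 / 4 / a + 1 ≤ A := by
    have : 3 / 4 / a = 3 / 2 / a / 2 := by ring
    linarith
  have hc : 1 < x + 1 / 2 := by linarith
  set Z : ℝ := ∑' n : ℕ, ((n : ℝ) + 1) ^ (-(x + 1 / 2)) with hZ
  have hZ0 : 0 ≤ Z := tsum_nonneg fun n => by positivity
  set C : ℝ := 2 + 8 / a with hC
  have hC0 : 0 ≤ C := by positivity
  have hcont (T : ℝ) : Continuous (archRatio (α T)) :=
    continuous_archRatio (by rw [hre]; linarith)
  have hle (T τ : ℝ) : ‖archRatio (α T) τ‖ ≤ C * Real.exp (9 / 16 * a * τ ^ 2) :=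
    norm_archRatio_le ha (by rw [hre]; exact hA2) (by rw [hre]; exact hAa) τ
  have hle1 (T τ : ℝ) : ‖archRatio (α T) τ - 1‖ ≤ (C + 1) * Real.exp (9 / 16 * a * τ ^ 2) := by
    refine (norm_sub_le _ _).trans ?_
    rw [norm_one, add_mul, one_mul]
    exact add_le_add (hle T τ) (Real.one_le_exp (by positivity))
  have hdom (T τ : ℝ) : Real.exp (-(3 / 4 * a) * τ ^ 2) * ‖archRatio (α T) τ - 1‖ ≤
      (C + 1) * Real.exp (-(3 / 16 * a) * τ ^ 2) := by
    refine (mul_le_mul_of_nonneg_left (hle1 T τ) (Real.exp_pos _).le).trans (le_of_eq ?_)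
    rw [show -(3 / 16 * a) * τ ^ 2 = -(3 / 4 * a) * τ ^ 2 + 9 / 16 * a * τ ^ 2 by ring,
      Real.exp_add]
    ring
  have hdi : Integrable fun τ : ℝ => (C + 1) * Real.exp (-(3 / 16 * a) * τ ^ 2) :=
    (integrable_exp_neg_mul_sq (by positivity)).const_mul _
  have hmeas (T : ℝ) : AEStronglyMeasurable
      (fun τ : ℝ => Real.exp (-(3 / 4 * a) * τ ^ 2) * ‖archRatio (α T) τ - 1‖) volume := by
    have := hcont T
    apply Continuous.aestronglyMeasurable
    fun_prop
  have h_int (T : ℝ) : Integrable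
      (fun τ : ℝ => Real.exp (-(3 / 4 * a) * τ ^ 2) * ‖archRatio (α T) τ - 1‖) :=
    hdi.mono' (hmeas T) (Eventually.of_forall fun τ => by
      rw [Real.norm_of_nonneg (by positivity)]; exact hdom T τ)
  refine ⟨fun T => Real.exp (4 * a * ρ ^ 2) * Z *
    ∫ τ : ℝ, Real.exp (-(3 / 4 * a) * τ ^ 2) * ‖archRatio (α T) τ - 1‖, ?_, fun T p hp => ?_⟩
  · have hlim := tendsto_integral_filter_of_dominated_convergence (μ := volume) (l := atTop)
      (F := fun (T : ℝ) (τ : ℝ) => Real.exp (-(3 / 4 * a) * τ ^ 2) * ‖archRatio (α T) τ - 1‖)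
      (f := fun _ => (0 : ℝ)) (fun τ : ℝ => (C + 1) * Real.exp (-(3 / 16 * a) * τ ^ 2))
      (Eventually.of_forall hmeas)
      (Eventually.of_forall fun T => Eventually.of_forall fun τ => by
        rw [Real.norm_of_nonneg (by positivity)]; exact hdom T τ) hdi
      (Eventually.of_forall fun τ => by
        have h := ((tendsto_archRatio (by linarith : 1 ≤ A) τ).sub_const 1).norm.const_mul
          (Real.exp (-(3 / 4 * a) * τ ^ 2))
        simpa [hα] using h)
    simpa using hlim.const_mul (Real.exp (4 * a * ρ ^ 2) * Z)
  · rw [← gaussTransform_zetaSeries ha hc, gaussTransform, gaussTransform]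
    have hz := continuous_zetaSeries_line hc T
    have hzn (τ : ℝ) : ‖zetaSeries ((x + 1 / 2 : ℝ) + Complex.I * (T + τ))‖ ≤ Z :=
      norm_zetaSeries_le hc (by simp)
    have hi2 : Integrable fun τ : ℝ => shiftedGaussian a p τ *
        zetaSeries ((x + 1 / 2 : ℝ) + Complex.I * (T + τ)) :=
      (integrable_shiftedGaussian ha p).mul_bdd (c := Z) hz.aestronglyMeasurable
        (Eventually.of_forall hzn)
    have hbd (τ : ℝ) : ‖shiftedGaussian a p τ * ((archRatio (α T) τ - 1) *
        zetaSeries ((x + 1 / 2 : ℝ) + Complex.I * (T + τ)))‖ ≤ Real.exp (4 * a * ρ ^ 2) * Z *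
        (Real.exp (-(3 / 4 * a) * τ ^ 2) * ‖archRatio (α T) τ - 1‖) := by
      rw [norm_mul, norm_mul]
      refine (mul_le_mul (norm_shiftedGaussian_le ha hp τ)
        (mul_le_mul_of_nonneg_left (hzn τ) (norm_nonneg _)) (by positivity)
        (by positivity)).trans (le_of_eq ?_)
      ring
    have hi3 : Integrable fun τ : ℝ => shiftedGaussian a p τ * ((archRatio (α T) τ - 1) *
        zetaSeries ((x + 1 / 2 : ℝ) + Complex.I * (T + τ))) := by
      refine ((h_int T).const_mul (Real.exp (4 * a * ρ ^ 2) * Z)).mono' ?_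
        (Eventually.of_forall hbd)
      have := hcont T
      apply Continuous.aestronglyMeasurable
      unfold shiftedGaussian
      fun_prop
    have hi1 : Integrable fun τ : ℝ => shiftedGaussian a p τ * (archRatio (α T) τ *
        zetaSeries ((x + 1 / 2 : ℝ) + Complex.I * (T + τ))) := by
      refine (hi3.add hi2).congr (Eventually.of_forall fun τ => ?_)
      simp only [Pi.add_apply]
      ring
    rw [← integral_sub hi1 hi2]
    simp only
    rw [← integral_const_mul]
    refine norm_integral_le_of_norm_le ((h_int T).const_mul _) (Eventually.of_forall fun τ => ?_)
    refine le_trans (le_of_eq ?_) (hbd τ)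
    congr 1
    ring

/-- Simultaneous recurrence for countably many circle rotations. -/
lemma exists_recurrence (L : ℕ → ℝ) : ∃ T : ℕ → ℝ, Tendsto T atTop atTop ∧
    ∀ n, Tendsto (fun k => Complex.exp (-Complex.I * T k * L n)) atTop (𝓝 1) := by
  set X : ℕ → ℕ → Circle := fun j n => Circle.exp (-(j * L n)) with hX
  obtain ⟨y, -, φ, hφ, hlim⟩ := (isCompact_univ (X := ℕ → Circle)).isSeqCompact
    (x := X) (fun _ => Set.mem_univ _)
  have hge (k : ℕ) : φ k + k ≤ φ (φ k + k) := hφ.id_le _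
  refine ⟨fun k => (φ (φ k + k) : ℝ) - φ k, ?_, fun n => ?_⟩
  · refine tendsto_atTop_mono (fun k => ?_) tendsto_natCast_atTop_atTop
    have : ((φ k + k : ℕ) : ℝ) ≤ φ (φ k + k) := by exact_mod_cast hge k
    push_cast at this
    linarith
  · have hn := (tendsto_pi_nhds.1 hlim) n
    have hsub : Tendsto (fun k => φ k + k) atTop atTop :=
      tendsto_atTop_mono (fun k => Nat.le_add_left k _) tendsto_id
    have h1 := (hn.comp hsub).div' hn
    rw [div_self'] at h1
    have h2 := ((continuous_subtype_val
      (p := fun z : ℂ => z ∈ Submonoid.unitSphere ℂ)).tendsto _).comp h1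
    refine h2.congr fun k => ?_
    simp only [Function.comp, hX, ← Circle.exp_sub, Circle.coe_exp]
    congr 1
    push_cast
    ring

lemma norm_gaussDirichlet_term (a : ℝ) (w : ℂ) (n : ℕ) :
    ‖Complex.exp (-w * Real.log (n + 1) - (Real.log (n + 1)) ^ 2 / (4 * a))‖ =
      Real.exp (-w.re * Real.log (n + 1) - (Real.log (n + 1)) ^ 2 / (4 * a)) := by
  rw [Complex.norm_exp]
  congr 1
  have : (-w * Real.log (n + 1) - (Real.log (n + 1) : ℂ) ^ 2 / (4 * a)) =
      -w * (Real.log (n + 1) : ℝ) - ((Real.log (n + 1) ^ 2 / (4 * a) : ℝ) : ℂ) := by push_cast; ring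
  rw [this, Complex.sub_re, Complex.ofReal_re, Complex.re_mul_ofReal, Complex.neg_re]

lemma gaussDirichlet_exponent_le {a : ℝ} (ha : 0 < a) (σ L : ℝ) :
    -σ * L - L ^ 2 / (4 * a) ≤ a * (2 - σ) ^ 2 + -2 * L := by
  have h : a * (2 - σ) ^ 2 + -2 * L - (-σ * L - L ^ 2 / (4 * a)) =
      (2 * a * (2 - σ) - L) ^ 2 / (4 * a) := by field_simp; ring
  have : 0 ≤ (2 * a * (2 - σ) - L) ^ 2 / (4 * a) := by positivity
  linarith

lemma exp_gaussDirichlet_le {a : ℝ} (ha : 0 < a) (σ : ℝ) (n : ℕ) :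
    Real.exp (-σ * Real.log (n + 1) - (Real.log (n + 1)) ^ 2 / (4 * a)) ≤
      Real.exp (a * (2 - σ) ^ 2) * ((n : ℝ) + 1) ^ (-2 : ℝ) := by
  rw [Real.rpow_def_of_pos (by positivity), ← Real.exp_add, mul_comm (Real.log _) (-2)]
  exact Real.exp_le_exp.2 (gaussDirichlet_exponent_le ha σ _)

lemma summable_exp_gaussDirichlet {a : ℝ} (ha : 0 < a) (σ : ℝ) : Summable fun n : ℕ =>
    Real.exp (-σ * Real.log (n + 1) - (Real.log (n + 1)) ^ 2 / (4 * a)) :=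
  Summable.of_nonneg_of_le (fun _ => (Real.exp_pos _).le) (exp_gaussDirichlet_le ha σ)
    ((summable_rpow_neg one_lt_two).mul_left _)

lemma summable_gaussDirichlet {a : ℝ} (ha : 0 < a) (w : ℂ) : Summable fun n : ℕ =>
    Complex.exp (-w * Real.log (n + 1) - (Real.log (n + 1)) ^ 2 / (4 * a)) :=
  Summable.of_norm (by
    simp only [norm_gaussDirichlet_term]
    exact summable_exp_gaussDirichlet ha w.re)

lemma exists_uniform_gaussDirichlet_recurrence {a : ℝ} (ha : 0 < a) (c ρ : ℝ) {T : ℕ → ℝ}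
    (hT : ∀ n : ℕ, Tendsto (fun k => Complex.exp (-Complex.I * T k * Real.log (n + 1))) atTop
      (𝓝 1)) :
    ∃ δ : ℕ → ℝ, Tendsto δ atTop (𝓝 0) ∧ ∀ k : ℕ, ∀ p : ℂ, ‖p‖ ≤ ρ →
      ‖gaussDirichlet a (c + Complex.I * T k + p) - gaussDirichlet a (c + p)‖ ≤ δ k := by
  set w : ℕ → ℝ := fun n =>
    Real.exp (-(c - ρ) * Real.log (n + 1) - (Real.log (n + 1)) ^ 2 / (4 * a)) with hw
  have hws : Summable w := summable_exp_gaussDirichlet ha (c - ρ)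
  have hE (k n : ℕ) : ‖Complex.exp (-Complex.I * T k * Real.log (n + 1))‖ = 1 := by
    rw [Complex.norm_exp]; simp
  have hE2 (k n : ℕ) : ‖Complex.exp (-Complex.I * T k * Real.log (n + 1)) - 1‖ ≤ 2 := by
    refine (norm_sub_le _ _).trans ?_
    rw [hE, norm_one]; norm_num
  have hs (k : ℕ) : Summable fun n : ℕ =>
      ‖Complex.exp (-Complex.I * T k * Real.log (n + 1)) - 1‖ * w n :=
    Summable.of_nonneg_of_le (fun n => by positivity)
      (fun n => mul_le_mul_of_nonneg_right (hE2 k n) (Real.exp_pos _).le) (hws.mul_left 2)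
  refine ⟨fun k => ∑' n : ℕ,
    ‖Complex.exp (-Complex.I * T k * Real.log ((n : ℕ) + 1)) - 1‖ * w n, ?_,
    fun k p hp => ?_⟩
  · have h := tendsto_tsum_of_dominated_convergence (𝓕 := atTop)
      (f := fun (k n : ℕ) => ‖Complex.exp (-Complex.I * T k * Real.log (n + 1)) - 1‖ * w n)
      (g := fun _ => (0 : ℝ)) (bound := fun n => 2 * w n) (hws.mul_left 2)
      (fun n => by
        have := (((hT n).sub_const 1).norm).mul_const (w n)
        simpa using this)
      (Eventually.of_forall fun k n => by
        rw [Real.norm_of_nonneg (by positivity)]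
        exact mul_le_mul_of_nonneg_right (hE2 k n) (Real.exp_pos _).le)
    simpa using h
  · rw [gaussDirichlet, gaussDirichlet, ← Summable.tsum_sub (summable_gaussDirichlet ha _)
      (summable_gaussDirichlet ha _)]
    refine tsum_of_norm_bounded (hs k).hasSum fun n => ?_
    have e : Complex.exp (-(c + Complex.I * T k + p) * Real.log (n + 1) -
        (Real.log (n + 1)) ^ 2 / (4 * a)) - Complex.exp (-(c + p) * Real.log (n + 1) -
        (Real.log (n + 1)) ^ 2 / (4 * a)) =
        (Complex.exp (-Complex.I * T k * Real.log (n + 1)) - 1) *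
        Complex.exp (-(c + p) * Real.log (n + 1) - (Real.log (n + 1)) ^ 2 / (4 * a)) := by
      rw [sub_mul, one_mul, ← Complex.exp_add]
      ring_nf
    rw [e, norm_mul, norm_gaussDirichlet_term]
    refine mul_le_mul_of_nonneg_left (Real.exp_le_exp.2 ?_) (norm_nonneg _)
    have hl : 0 ≤ Real.log ((n : ℝ) + 1) := Real.log_nonneg (by
      have : (0 : ℝ) ≤ n := n.cast_nonneg
      linarith)
    have h1 : -ρ ≤ p.re := by linarith [neg_abs_le p.re, Complex.abs_re_le_norm p]
    have h2 : -((c : ℂ) + p).re ≤ -(c - ρ) := by simp; linarith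
    linarith [mul_le_mul_of_nonneg_right h2 hl]

lemma differentiable_gaussDirichlet {a : ℝ} (ha : 0 < a) : Differentiable ℂ (gaussDirichlet a) := by
  intro w₀
  set R : ℝ := ‖w₀‖ + 1 with hR
  have h := Complex.differentiableOn_tsum_of_summable_norm (U := Metric.ball 0 R)
    (F := fun (n : ℕ) (w : ℂ) =>
      Complex.exp (-w * Real.log (n + 1) - (Real.log (n + 1)) ^ 2 / (4 * a)))
    (summable_exp_gaussDirichlet ha (-R)) (fun n => by fun_prop) Metric.isOpen_ball
    (fun n w hw => by
      rw [norm_gaussDirichlet_term]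
      refine Real.exp_le_exp.2 ?_
      have hl : 0 ≤ Real.log ((n : ℝ) + 1) := Real.log_nonneg (by
        have : (0 : ℝ) ≤ n := n.cast_nonneg
        linarith)
      have h1 : -w.re ≤ -(-R) := by
        have : ‖w‖ < R := by simpa using hw
        linarith [neg_abs_le w.re, Complex.abs_re_le_norm w]
      linarith [mul_le_mul_of_nonneg_right h1 hl])
  exact h.differentiableAt (Metric.isOpen_ball.mem_nhds (by simp [hR]))

lemma norm_gaussDirichlet_le {a : ℝ} (ha : 0 < a) (w : ℂ) :
    ‖gaussDirichlet a w‖ ≤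
      Real.exp (a * (2 + ‖w‖) ^ 2) * ∑' n : ℕ, ((n : ℝ) + 1) ^ (-2 : ℝ) := by
  have h := tsum_of_norm_bounded (((summable_rpow_neg one_lt_two).mul_left
    (Real.exp (a * (2 - w.re) ^ 2))).hasSum) fun n => by
      rw [norm_gaussDirichlet_term]; exact exp_gaussDirichlet_le ha w.re n
  rw [tsum_mul_left] at h
  refine h.trans (mul_le_mul_of_nonneg_right (Real.exp_le_exp.2
    (mul_le_mul_of_nonneg_left ?_ ha.le)) (tsum_nonneg fun n => by positivity))
  have h1 := abs_le.1 (Complex.abs_re_le_norm w)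
  exact sq_le_sq' (by linarith) (by linarith)

/-- A nowhere vanishing entire function is the exponential of an entire function. -/
lemma exists_entire_log {F : ℂ → ℂ} (hF : Differentiable ℂ F) (h0 : ∀ w, F w ≠ 0) :
    ∃ g : ℂ → ℂ, Differentiable ℂ g ∧ ∀ w, F w = Complex.exp (g w) := by
  have hd : Differentiable ℂ (fun w => deriv F w / F w) :=
    (hF.contDiff.differentiable_deriv_two).div hF h0
  obtain ⟨g, hg0, hg⟩ := hd.isExactOn_univ.with_val_at 0 (Complex.log (F 0))
  have hg' : ∀ w, HasDerivAt g (deriv F w / F w) w := fun w => hg w trivial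
  have hgd : Differentiable ℂ g := fun w => (hg' w).differentiableAt
  refine ⟨g, hgd, ?_⟩
  have hder : ∀ w, HasDerivAt (fun w => F w * Complex.exp (-g w)) 0 w := by
    intro w
    have h := (hF w).hasDerivAt.mul (hg' w).neg.cexp
    have e : deriv F w * Complex.exp (-g w) +
        F w * (Complex.exp (-g w) * -(deriv F w / F w)) = 0 := by
      have := h0 w
      field_simp
      ring
    exact e ▸ h
  intro w
  have hc := is_const_of_deriv_eq_zero (fun w => (hder w).differentiableAt)
    (fun w => (hder w).deriv) w 0
  simp only [hg0, Complex.exp_neg, Complex.exp_log (h0 0)] at hc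
  rw [mul_inv_cancel₀ (h0 0)] at hc
  field_simp at hc
  exact hc

/-- An entire function whose real part grows at most quadratically is a quadratic polynomial. -/
lemma eq_quadratic_of_re_le {g : ℂ → ℂ} (hg : Differentiable ℂ g) {C : ℝ} (hC : 0 < C)
    (hre : ∀ w, (g w).re ≤ C * (1 + ‖w‖) ^ 2) :
    ∃ c₀ c₁ c₂ : ℂ, ∀ w, g w = c₀ + c₁ * w + c₂ * w ^ 2 := by
  have hbd : ∀ R : ℝ, 1 ≤ R → ∀ z ∈ Metric.sphere (0 : ℂ) R,
      ‖g z‖ ≤ (18 * C + 3 * ‖g 0‖) * R ^ 2 := by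
    intro R hR z hz
    have hz' : ‖z‖ = R := by simpa using hz
    have h := Complex.borelCaratheodory (f := g) (R := 2 * R) (M := C * (1 + 2 * R) ^ 2) (z := z)
      (by positivity) hg.differentiableOn ?_ (by linarith) (by simp [hz']; linarith)
    · rw [hz'] at h
      have e : 2 * (C * (1 + 2 * R) ^ 2) * R / (2 * R - R) + ‖g 0‖ * (2 * R + R) / (2 * R - R)
          = 2 * C * (1 + 2 * R) ^ 2 + 3 * ‖g 0‖ := by
        have : 2 * R - R ≠ 0 := by linarith
        field_simp
        ring
      rw [e] at h
      have h1 : (1 + 2 * R) ^ 2 ≤ 9 * R ^ 2 := by nlinarith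
      have h2 : ‖g 0‖ ≤ ‖g 0‖ * R ^ 2 := le_mul_of_one_le_right (norm_nonneg _) (by nlinarith)
      nlinarith [mul_le_mul_of_nonneg_left h1 hC.le]
    · intro w hw
      have hw' : ‖w‖ ≤ 2 * R := by simpa using (Metric.mem_ball.1 hw).le
      refine (hre w).trans ?_
      gcongr
  have hzero : ∀ n : ℕ, 3 ≤ n → iteratedDeriv n g 0 = 0 := by
    intro n hn
    have hlim : Tendsto (fun R : ℝ => (n.factorial : ℝ) * (18 * C + 3 * ‖g 0‖) / R) atTop (𝓝 0) :=
      tendsto_const_nhds.div_atTop tendsto_id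
    refine norm_le_zero_iff.1 (ge_of_tendsto hlim ?_)
    filter_upwards [eventually_ge_atTop 1] with R hR
    refine (Complex.norm_iteratedDeriv_le_of_forall_mem_sphere_norm_le n (by linarith)
      hg.diffContOnCl (hbd R hR)).trans ?_
    have hR0 : 0 < R := by linarith
    rw [div_le_div_iff₀ (by positivity) hR0]
    have h3 : R ^ 3 ≤ R ^ n := pow_le_pow_right₀ hR hn
    calc (n.factorial : ℝ) * ((18 * C + 3 * ‖g 0‖) * R ^ 2) * R
        = n.factorial * (18 * C + 3 * ‖g 0‖) * R ^ 3 := by ring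
      _ ≤ _ := by gcongr
  refine ⟨g 0, iteratedDeriv 1 g 0, 2⁻¹ * iteratedDeriv 2 g 0, fun w => ?_⟩
  rw [← Complex.taylorSeries_eq_of_entire' 0 w hg, tsum_eq_sum (s := range 3)]
  · simp [sum_range_succ]
  · intro n hn
    rw [hzero n (by simpa using hn)]
    simp

lemma tendsto_gaussDirichlet_atTop {a : ℝ} (ha : 0 < a) :
    Tendsto (fun σ : ℝ => gaussDirichlet a σ) atTop (𝓝 1) := by
  have h1 : (∑' n : ℕ, if n = 0 then (1 : ℂ) else 0) = 1 := tsum_ite_eq 0 _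
  rw [← h1]
  refine tendsto_tsum_of_dominated_convergence (summable_exp_gaussDirichlet ha 0) ?_ ?_
  · intro n
    rcases Nat.eq_zero_or_pos n with rfl | hn
    · simp
    · rw [if_neg hn.ne', tendsto_zero_iff_norm_tendsto_zero]
      simp only [norm_gaussDirichlet_term, Complex.ofReal_re]
      have hL : 0 < Real.log ((n : ℝ) + 1) := Real.log_pos (by
        have : (0 : ℝ) < n := by exact_mod_cast hn
        linarith)
      refine Real.tendsto_exp_atBot.comp ?_
      refine tendsto_atBot_add_const_right _ _ ?_
      simp only [neg_mul]
      exact tendsto_neg_atTop_atBot.comp (tendsto_id.atTop_mul_const hL)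
  · filter_upwards [eventually_ge_atTop 0] with σ hσ n
    rw [norm_gaussDirichlet_term, Complex.ofReal_re]
    have hL : 0 ≤ Real.log ((n : ℝ) + 1) := Real.log_nonneg (by
      have : (0 : ℝ) ≤ n := n.cast_nonneg
      linarith)
    gcongr

lemma one_lt_norm_gaussDirichlet_zero {a : ℝ} (ha : 0 < a) : 1 < ‖gaussDirichlet a 0‖ := by
  have hs := summable_exp_gaussDirichlet ha 0
  have e : gaussDirichlet a 0 = ((∑' n : ℕ, Real.exp
      (-0 * Real.log ((n : ℝ) + 1) - (Real.log ((n : ℝ) + 1)) ^ 2 / (4 * a)) : ℝ) : ℂ) := by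
    rw [gaussDirichlet, Complex.ofReal_tsum]
    push_cast
    rfl
  rw [e, Complex.norm_real]
  refine lt_of_lt_of_le ?_ (le_abs_self _)
  refine lt_of_lt_of_le ?_ (hs.sum_le_tsum (range 2) fun n _ => by positivity)
  rw [sum_range_succ, sum_range_one]
  simp only [Nat.cast_zero, zero_add, Real.log_one]
  norm_num
  positivity

/-- The series `gaussDirichlet a` has a complex zero: otherwise it would be the exponential of a
quadratic polynomial, which is incompatible with its behaviour on the positive real axis. -/
lemma exists_gaussDirichlet_eq_zero {a : ℝ} (ha : 0 < a) : ∃ w, gaussDirichlet a w = 0 := by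
  by_contra! h0
  obtain ⟨g, hg, hF⟩ := exists_entire_log (differentiable_gaussDirichlet ha) h0
  have hnorm : ∀ w, ‖gaussDirichlet a w‖ = Real.exp (g w).re := fun w => by
    rw [hF, Complex.norm_exp]
  set S : ℝ := ∑' n : ℕ, ((n : ℝ) + 1) ^ (-2 : ℝ)
  have hre : ∀ w, (g w).re ≤ (4 * a + |S|) * (1 + ‖w‖) ^ 2 := by
    intro w
    have h := norm_gaussDirichlet_le ha w
    have hS : S ≤ Real.exp |S| := (le_abs_self S).trans (by linarith [Real.add_one_le_exp |S|])
    have h' : Real.exp (g w).re ≤ Real.exp (a * (2 + ‖w‖) ^ 2 + |S|) := by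
      rw [← hnorm, Real.exp_add]
      exact h.trans (by gcongr)
    have h2 := Real.exp_le_exp.1 h'
    have hw := norm_nonneg w
    have h3 : (2 + ‖w‖) ^ 2 ≤ 4 * (1 + ‖w‖) ^ 2 := by nlinarith
    have h4 : |S| ≤ |S| * (1 + ‖w‖) ^ 2 := le_mul_of_one_le_right (abs_nonneg _) (by nlinarith)
    nlinarith [mul_le_mul_of_nonneg_left h3 ha.le]
  obtain ⟨c₀, c₁, c₂, hq⟩ := eq_quadratic_of_re_le hg (by positivity) hre
  have hreal : ∀ σ : ℝ, (g σ).re = c₀.re + c₁.re * σ + c₂.re * σ ^ 2 := by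
    intro σ
    rw [hq, ← Complex.ofReal_pow]
    simp [-Complex.ofReal_pow]
  have hlim : Tendsto (fun σ : ℝ => c₀.re + c₁.re * σ + c₂.re * σ ^ 2) atTop (𝓝 0) := by
    have h1 : Tendsto (fun σ : ℝ => Real.log ‖gaussDirichlet a σ‖) atTop (𝓝 0) := by
      have := (tendsto_gaussDirichlet_atTop ha).norm.log (by simp)
      simpa using this
    refine h1.congr fun σ => ?_
    rw [hnorm, Real.log_exp, hreal]
  have hshift : ∀ f : ℝ → ℝ, Tendsto f atTop (𝓝 0) →
      Tendsto (fun σ => f (σ + 1) - f σ) atTop (𝓝 0) := by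
    intro f hf
    simpa using (hf.comp (tendsto_atTop_add_const_right atTop 1 tendsto_id)).sub hf
  have h1 := hshift _ hlim
  have h2 := hshift _ h1
  have hc2 : c₂.re = 0 := by
    have : Tendsto (fun _ : ℝ => 2 * c₂.re) atTop (𝓝 0) := h2.congr fun σ => by ring
    have := tendsto_nhds_unique tendsto_const_nhds this
    linarith
  have hc1 : c₁.re = 0 := by
    have : Tendsto (fun _ : ℝ => c₁.re) atTop (𝓝 0) := h1.congr fun σ => by rw [hc2]; ring
    exact tendsto_nhds_unique tendsto_const_nhds this
  have hc0 : c₀.re = 0 := by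
    have : Tendsto (fun _ : ℝ => c₀.re) atTop (𝓝 0) := hlim.congr fun σ => by rw [hc2, hc1]; ring
    exact tendsto_nhds_unique tendsto_const_nhds this
  have h3 := one_lt_norm_gaussDirichlet_zero ha
  have h4 := hreal 0
  rw [hnorm] at h3
  rw [hc0, Complex.ofReal_zero] at h4
  rw [h4] at h3
  simp at h3

/-- A form of Hurwitz's theorem: zeros of a nontrivial entire function persist, in a bounded
region, under locally uniform approximation by entire functions. -/
lemma eventually_exists_zero {D : ℕ → ℂ → ℂ} {G : ℂ → ℂ} (hD : ∀ k, Differentiable ℂ (D k))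
    (hG : Differentiable ℂ G) {p₀ q : ℂ} (h0 : G p₀ = 0) (hq : G q ≠ 0)
    (h : ∀ ρ : ℝ, ∃ δ : ℕ → ℝ, Tendsto δ atTop (𝓝 0) ∧
      ∀ᶠ k in atTop, ∀ p : ℂ, ‖p‖ ≤ ρ → ‖D k p - G p‖ ≤ δ k) :
    ∃ ρ : ℝ, ∀ᶠ k in atTop, ∃ p : ℂ, ‖p‖ ≤ ρ ∧ D k p = 0 := by
  have hGa : AnalyticOnNhd ℂ G Set.univ := fun z _ => hG.analyticAt z
  have hne : ∀ᶠ z in 𝓝[≠] p₀, G z ≠ 0 := by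
    rcases (hG.analyticAt p₀).eventually_eq_zero_or_eventually_ne_zero with hz | hz
    · exact absurd (hGa.eqOn_zero_of_preconnected_of_eventuallyEq_zero isPreconnected_univ
        (Set.mem_univ p₀) hz (Set.mem_univ q)) hq
    · exact hz
  rw [eventually_nhdsWithin_iff, Metric.nhds_basis_closedBall.eventually_iff] at hne
  obtain ⟨r, hr, hne⟩ := hne
  have hsph : ∀ z ∈ Metric.sphere p₀ r, G z ≠ 0 := fun z hz =>
    hne (Metric.sphere_subset_closedBall hz) (Metric.ne_of_mem_sphere hz hr.ne')
  obtain ⟨z₁, hz₁, hmin⟩ := (isCompact_sphere p₀ r).exists_isMinOn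
    (NormedSpace.sphere_nonempty.2 hr.le) hG.continuous.norm.continuousOn
  set m := ‖G z₁‖
  have hm : 0 < m := norm_pos_iff.2 (hsph z₁ hz₁)
  have hball : ∀ z ∈ Metric.closedBall p₀ r, ‖z‖ ≤ ‖p₀‖ + r := fun z hz => by
    have h1 : ‖z - p₀‖ ≤ r := mem_closedBall_iff_norm.1 hz
    linarith [norm_sub_norm_le z p₀]
  obtain ⟨δ, hδ, hDG⟩ := h (‖p₀‖ + r)
  refine ⟨‖p₀‖ + r, ?_⟩
  filter_upwards [hDG, hδ.eventually (gt_mem_nhds (half_pos hm))] with k hk hkm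
  by_contra! hno
  have hno' : ∀ z ∈ Metric.closedBall p₀ r, D k z ≠ 0 := fun z hz => hno z (hball z hz)
  have hinv : DiffContOnCl ℂ (fun z => (D k z)⁻¹) (Metric.ball p₀ r) :=
    (hD k).diffContOnCl.inv fun z hz => hno' z (by rwa [closure_ball p₀ hr.ne'] at hz)
  have hle : ‖(D k p₀)⁻¹‖ ≤ (m / 2)⁻¹ := by
    refine Complex.norm_le_of_forall_mem_frontier_norm_le Metric.isBounded_ball hinv
      (fun z hz => ?_) (subset_closure (Metric.mem_ball_self hr))
    rw [frontier_ball p₀ hr.ne'] at hz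
    rw [norm_inv]
    have h1 := hk z (hball z (Metric.sphere_subset_closedBall hz))
    have h2 : m ≤ ‖G z‖ := hmin hz
    have h3 := norm_sub_norm_le (G z) (D k z)
    rw [norm_sub_rev] at h3
    exact inv_anti₀ (half_pos hm) (by linarith)
  rw [norm_inv] at hle
  have hp : D k p₀ ≠ 0 := hno' p₀ (Metric.mem_closedBall_self hr.le)
  have h1 := (inv_le_inv₀ (norm_pos_iff.2 hp) (half_pos hm)).1 hle
  have h2 := hk p₀ (hball p₀ (Metric.mem_closedBall_self hr.le))
  rw [h0, sub_zero] at h2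
  linarith

/-- For every `λ < 0` the function `H λ` has a non-real zero. -/
lemma exists_nonreal_zero {lam : ℝ} (hlam : lam < 0) : ∃ z : ℂ, z.im ≠ 0 ∧ H lam z = 0 := by
  obtain ⟨a, ha, rfl⟩ : ∃ a : ℝ, 0 < a ∧ lam = -(1 / a) :=
    ⟨-(1 / lam), by
      have := one_div_neg.2 hlam
      linarith, by field_simp⟩
  set x : ℝ := 2 + 3 / 2 / a with hxdef
  have hxa : 3 / 2 / a ≤ x := by linarith
  have hx : 2 ≤ x := by
    have : 0 < 3 / 2 / a := by positivity
    linarith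
  set c : ℝ := x + 1 / 2 with hc
  set K : ℂ := (Real.pi / a : ℂ) ^ (1 / 2 : ℂ) with hKdef
  have hK : K ≠ 0 := gaussian_const_ne_zero ha
  obtain ⟨T, hT, hrec⟩ := exists_recurrence fun n => Real.log ((n : ℝ) + 1)
  replace hrec : ∀ n : ℕ, Tendsto (fun k => Complex.exp (-Complex.I * T k * Real.log (n + 1)))
      atTop (𝓝 1) := fun n => by simpa using hrec n
  set α : ℕ → ℂ := fun k =>
    ((5 / 4 + x / 2 : ℝ) : ℂ) + Complex.I * ((T k / 2 : ℝ) : ℂ) with hα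
  have hαre : ∀ k, (α k).re = 5 / 4 + x / 2 := fun k => by simp [hα]
  set D : ℕ → ℂ → ℂ := fun k => gaussTransform a (fun τ =>
    archRatio (α k) τ * zetaSeries ((x + 1 / 2 : ℝ) + Complex.I * (T k + τ))) with hDdef
  have hD : ∀ k, Differentiable ℂ (D k) := by
    intro k
    have hα2 : 2 ≤ (α k).re := by rw [hαre]; linarith
    have hαa : 3 / 4 / a + 1 ≤ (α k).re := by
      rw [hαre, hxdef]
      have : 3 / 4 / a = (3 / 2 / a) / 2 := by ring
      linarith
    refine differentiable_gaussTransform ha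
      (B := (2 + 8 / a) * ∑' n : ℕ, ((n : ℝ) + 1) ^ (-c))
      ((continuous_archRatio (by linarith)).mul (continuous_zetaSeries_line (by linarith) _))
      fun τ => ?_
    rw [norm_mul]
    have h1 := norm_archRatio_le ha hα2 hαa τ
    have h2 := norm_zetaSeries_le (c := c) (s := ((x + 1 / 2 : ℝ) + Complex.I * (T k + τ)))
      (by linarith) (by simp [hc])
    calc _ ≤ ((2 + 8 / a) * Real.exp (9 / 16 * a * τ ^ 2)) *
          ∑' n : ℕ, ((n : ℝ) + 1) ^ (-c) := by gcongr
      _ = _ := by ring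
  set G : ℂ → ℂ := fun p => K * gaussDirichlet a (c + p) with hGdef
  have hG : Differentiable ℂ G :=
    ((differentiable_gaussDirichlet ha).comp (differentiable_id.const_add _)).const_mul _
  obtain ⟨w₀, hw₀⟩ := exists_gaussDirichlet_eq_zero ha
  have hG0 : G (w₀ - c) = 0 := by simp [hGdef, hw₀]
  have hGq : G (-c) ≠ 0 := by
    have : gaussDirichlet a 0 ≠ 0 :=
      norm_pos_iff.1 (one_pos.trans (one_lt_norm_gaussDirichlet_zero ha))
    simp [hGdef, this, hK]
  obtain ⟨ρ, hρ⟩ := eventually_exists_zero hD hG hG0 hGq fun ρ => by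
    obtain ⟨δ₁, hδ₁, h₁⟩ := exists_uniform_gaussTransform_approx ha hx hxa ρ
    obtain ⟨δ₂, hδ₂, h₂⟩ := exists_uniform_gaussDirichlet_recurrence ha c ρ hrec
    refine ⟨fun k => δ₁ (T k) + ‖K‖ * δ₂ k, ?_, Eventually.of_forall fun k p hp => ?_⟩
    · simpa using (hδ₁.comp hT).add (hδ₂.const_mul ‖K‖)
    · have e : D k p - G p = (D k p - K * gaussDirichlet a (c + Complex.I * T k + p)) +
          K * (gaussDirichlet a (c + Complex.I * T k + p) - gaussDirichlet a (c + p)) := by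
        simp only [hGdef]; ring
      rw [e]
      refine (norm_add_le _ _).trans (add_le_add (h₁ (T k) p hp) ?_)
      rw [norm_mul]
      exact mul_le_mul_of_nonneg_left (h₂ k p hp) (norm_nonneg _)
  have hre : Tendsto (fun k => (digammaSeries (α k)).re) atTop atTop :=
    (tendsto_digammaSeries_re (A := 5 / 4 + x / 2) (by linarith)).comp
      (hT.atTop_div_const two_pos)
  have hslope : ∀ᶠ k in atTop, 4 * a * ρ + Real.log Real.pi < (digammaSeries (α k)).re :=
    hre.eventually (eventually_gt_atTop _)
  obtain ⟨k, ⟨p, hpρ, hp⟩, hk⟩ := (hρ.and hslope).exists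
  refine ⟨-2 * Complex.I * (x + Complex.I * T k + (p + archSlope (α k) / (2 * a))), ?_, ?_⟩
  · have hpre : -ρ ≤ p.re := by linarith [neg_abs_le p.re, Complex.abs_re_le_norm p]
    have e : archSlope (α k) / (2 * a) = archSlope (α k) / ((2 * a : ℝ) : ℂ) := by push_cast; rfl
    have hs : (archSlope (α k) / (2 * a)).re =
        ((digammaSeries (α k)).re - Real.log Real.pi) / 2 / (2 * a) := by
      rw [e, Complex.div_ofReal_re, archSlope]
      simp
    have him : (-2 * Complex.I * (x + Complex.I * T k + (p + archSlope (α k) / (2 * a)))).im =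
        -2 * (x + (p.re + (archSlope (α k) / (2 * a)).re)) := by
      simp
    have hgt : ρ < ((digammaSeries (α k)).re - Real.log Real.pi) / 2 / (2 * a) := by
      rw [lt_div_iff₀ (by positivity)]
      linarith
    rw [him, hs]
    exact (by linarith : _ < (0 : ℝ)).ne
  · have h := H_eq_gaussTransform ha (x := x) (T := T k) (by linarith) p (α := α k) rfl
    change _ = _ * D k p at h
    rw [hp, mul_zero] at h
    have h2 : (2 : ℂ) * (Real.pi / a : ℂ) ^ (1 / 2 : ℂ) ≠ 0 := mul_ne_zero two_ne_zero hK
    exact (mul_eq_zero.1 h).resolve_left h2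

end DeBruijnNewman

/-- **Rodgers–Tao (Newman's conjecture).** For every real `λ < 0` the function `H(λ, ·)` has
a nonreal zero; equivalently, the De Bruijn–Newman constant
`Λ = inf {λ : H(λ', ·) has only real zeros for all λ' ≥ λ}` is nonnegative. -/
theorem rodgers_tao_newman_conjecture :
    (∀ lam : ℝ, lam < 0 → ∃ z : ℂ, z.im ≠ 0 ∧ H lam z = 0) ∧
      0 ≤ sInf {lam : ℝ | ∀ lam' : ℝ, lam ≤ lam' → ∀ z : ℂ, H lam' z = 0 → z.im = 0} := by
  refine ⟨fun lam hlam => DeBruijnNewman.exists_nonreal_zero hlam,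
    Real.sInf_nonneg fun lam hmem => ?_⟩
  by_contra! hlam
  obtain ⟨z, hz, h0⟩ := DeBruijnNewman.exists_nonreal_zero hlam
  exact hz (hmem lam le_rfl z h0)

end
end

section
/- (Newman, central limit theorem for associated sequences) Let (X_n)_{n ∈ ℤ} be a strictly stationary sequence of real random variables that is associated, with E[X_0²] < ∞, and suppose σ² := Var(X_0) + 2 Σ_{k=1}^∞ Cov(X_0, X_k) is finite and strictly positive. Then the normalized partial sums n^{−1/2} Σ_{j=1}^n (X_j − E[X_0]) converge in distribution, as n → ∞, to a centered Gaussian random variable with variance σ². -/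
open MeasureTheory Filter Topology

noncomputable section

/-- The covariance `Cov(f, g) = E[fg] − E[f] E[g]` under the measure `P`. -/
def cov {Ω : Type*} [MeasurableSpace Ω] (P : Measure Ω) (f g : Ω → ℝ) : ℝ :=
  (∫ ω, f ω * g ω ∂P) - (∫ ω, f ω ∂P) * (∫ ω, g ω ∂P)

/-- A family `X` of real random variables is associated if every finite subcollection
`X_{t 0}, …, X_{t (n-1)}` satisfies `Cov(f(X_t), g(X_t)) ≥ 0` for all bounded measurable
functions `f, g` that are nondecreasing in each coordinate. -/
def AssociatedFamily {Ω : Type*} [MeasurableSpace Ω] (P : Measure Ω) (X : ℤ → Ω → ℝ) : Prop :=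
  ∀ (n : ℕ) (t : Fin n → ℤ) (f g : (Fin n → ℝ) → ℝ),
    Measurable f → Measurable g →
    (∃ M, ∀ x, |f x| ≤ M) → (∃ M, ∀ x, |g x| ≤ M) →
    (∀ x y, (∀ j, x j ≤ y j) → f x ≤ f y) →
    (∀ x y, (∀ j, x j ≤ y j) → g x ≤ g y) →
    0 ≤ cov P (fun ω => f fun j => X (t j) ω) (fun ω => g fun j => X (t j) ω)

/-- A sequence of random variables is strictly stationary if its finite-dimensional joint
distributions are invariant under index shifts. -/
def StrictlyStationary {Ω : Type*} [MeasurableSpace Ω] (P : Measure Ω) (X : ℤ → Ω → ℝ) :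
    Prop :=
  ∀ (k : ℤ) (n : ℕ) (t : Fin n → ℤ),
    P.map (fun ω j => X (t j + k) ω) = P.map (fun ω j => X (t j) ω)

open ProbabilityTheory

section AssociatedPair

variable {Ω : Type*} [MeasurableSpace Ω] {P : Measure Ω} {U V : Ω → ℝ} {f g f₁ g₁ : ℝ → ℝ}

/-- Bounded nondecreasing functions of `U` and of `V` are nonnegatively correlated. -/
def AssociatedPair (P : Measure Ω) (U V : Ω → ℝ) : Prop :=
  ∀ f g : ℝ → ℝ, Monotone f → Monotone g →
    (∃ M, ∀ x, |f x| ≤ M) → (∃ M, ∀ x, |g x| ≤ M) →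
    0 ≤ cov P (fun ω => f (U ω)) (fun ω => g (V ω))

lemma covariance_eq_cov [IsProbabilityMeasure P] (hU : MemLp U 2 P) (hV : MemLp V 2 P) :
    covariance U V P = cov P U V :=
  covariance_eq_sub hU hV

/-- Truncation of a real number to the interval `[-n, n]`. -/
def truncate (n : ℕ) (x : ℝ) : ℝ := max (-n) (min n x)

lemma monotone_truncate (n : ℕ) : Monotone (truncate n) := fun _ _ h =>
  max_le_max le_rfl (min_le_min le_rfl h)

lemma abs_truncate_le (n : ℕ) (x : ℝ) : |truncate n x| ≤ n := by
  have hn : (0 : ℝ) ≤ n := n.cast_nonneg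
  rw [abs_le, truncate]
  grind

lemma abs_truncate_le_abs (n : ℕ) (x : ℝ) : |truncate n x| ≤ |x| := by
  have hn : (0 : ℝ) ≤ n := n.cast_nonneg
  rw [truncate]
  grind

lemma tendsto_truncate (x : ℝ) : Tendsto (fun n : ℕ => truncate n x) atTop (𝓝 x) := by
  refine tendsto_const_nhds.congr' ?_
  filter_upwards [eventually_ge_atTop ⌈|x|⌉₊] with n hn
  have h := abs_le.1 (Nat.ceil_le.1 hn)
  rw [truncate, min_eq_right h.2, max_eq_right h.1]

lemma tendsto_integral_truncate {F : Ω → ℝ} (hF : Integrable F P) :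
    Tendsto (fun n : ℕ => ∫ ω, truncate n (F ω) ∂P) atTop (𝓝 (∫ ω, F ω ∂P)) :=
  tendsto_integral_of_dominated_convergence (fun ω => |F ω|)
    (fun n => ((monotone_truncate n).measurable.comp_aemeasurable
      hF.aemeasurable).aestronglyMeasurable)
    hF.abs (fun n => ae_of_all _ fun ω => abs_truncate_le_abs n (F ω))
    (ae_of_all _ fun ω => tendsto_truncate (F ω))

lemma tendsto_integral_truncate_mul {F G : Ω → ℝ} (hF : MemLp F 2 P) (hG : MemLp G 2 P) :
    Tendsto (fun n : ℕ => ∫ ω, truncate n (F ω) * truncate n (G ω) ∂P) atTop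
      (𝓝 (∫ ω, F ω * G ω ∂P)) := by
  refine tendsto_integral_of_dominated_convergence (fun ω => |F ω * G ω|)
    (fun n => ?_) (hF.integrable_mul hG).abs (fun n => ae_of_all _ fun ω => ?_)
    (ae_of_all _ fun ω => (tendsto_truncate (F ω)).mul (tendsto_truncate (G ω)))
  · exact (((monotone_truncate n).measurable.comp_aemeasurable hF.aemeasurable).mul
      ((monotone_truncate n).measurable.comp_aemeasurable hG.aemeasurable)).aestronglyMeasurable
  · rw [Real.norm_eq_abs, abs_mul, abs_mul]
    exact mul_le_mul (abs_truncate_le_abs n _) (abs_truncate_le_abs n _) (abs_nonneg _)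
      (abs_nonneg _)

lemma AssociatedPair.covariance_nonneg [IsProbabilityMeasure P] (h : AssociatedPair P U V)
    (hf : Monotone f) (hg : Monotone g) (hfU : MemLp (fun ω => f (U ω)) 2 P)
    (hgV : MemLp (fun ω => g (V ω)) 2 P) :
    0 ≤ covariance (fun ω => f (U ω)) (fun ω => g (V ω)) P := by
  rw [covariance_eq_cov hfU hgV]
  refine ge_of_tendsto' ((tendsto_integral_truncate_mul hfU hgV).sub
    ((tendsto_integral_truncate (hfU.integrable one_le_two)).mul
      (tendsto_integral_truncate (hgV.integrable one_le_two)))) fun n => ?_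
  exact h (fun x => truncate n (f x)) (fun x => truncate n (g x))
    ((monotone_truncate n).comp hf) ((monotone_truncate n).comp hg)
    ⟨n, fun x => abs_truncate_le n _⟩ ⟨n, fun x => abs_truncate_le n _⟩

lemma AssociatedPair.abs_covariance_le [IsProbabilityMeasure P] (h : AssociatedPair P U V)
    (hf_add : Monotone fun x => f₁ x + f x) (hf_sub : Monotone fun x => f₁ x - f x)
    (hg_add : Monotone fun x => g₁ x + g x) (hg_sub : Monotone fun x => g₁ x - g x)
    (hf : MemLp (fun ω => f (U ω)) 2 P) (hf₁ : MemLp (fun ω => f₁ (U ω)) 2 P)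
    (hg : MemLp (fun ω => g (V ω)) 2 P) (hg₁ : MemLp (fun ω => g₁ (V ω)) 2 P) :
    |covariance (fun ω => f (U ω)) (fun ω => g (V ω)) P| ≤
      covariance (fun ω => f₁ (U ω)) (fun ω => g₁ (V ω)) P := by
  have add_add := h.covariance_nonneg hf_add hg_add (hf₁.add hf) (hg₁.add hg)
  have add_sub := h.covariance_nonneg hf_add hg_sub (hf₁.add hf) (hg₁.sub hg)
  have sub_add := h.covariance_nonneg hf_sub hg_add (hf₁.sub hf) (hg₁.add hg)
  have sub_sub := h.covariance_nonneg hf_sub hg_sub (hf₁.sub hf) (hg₁.sub hg)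
  change 0 ≤ covariance ((fun ω => f₁ (U ω)) + fun ω => f (U ω))
    ((fun ω => g₁ (V ω)) + fun ω => g (V ω)) P at add_add
  change 0 ≤ covariance ((fun ω => f₁ (U ω)) + fun ω => f (U ω))
    ((fun ω => g₁ (V ω)) - fun ω => g (V ω)) P at add_sub
  change 0 ≤ covariance ((fun ω => f₁ (U ω)) - fun ω => f (U ω))
    ((fun ω => g₁ (V ω)) + fun ω => g (V ω)) P at sub_add
  change 0 ≤ covariance ((fun ω => f₁ (U ω)) - fun ω => f (U ω))
    ((fun ω => g₁ (V ω)) - fun ω => g (V ω)) P at sub_sub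
  rw [covariance_add_left hf₁ hf (hg₁.add hg), covariance_add_right hf₁ hg₁ hg,
    covariance_add_right hf hg₁ hg] at add_add
  rw [covariance_add_left hf₁ hf (hg₁.sub hg), covariance_sub_right hf₁ hg₁ hg,
    covariance_sub_right hf hg₁ hg] at add_sub
  rw [covariance_sub_left hf₁ hf (hg₁.add hg), covariance_add_right hf₁ hg₁ hg,
    covariance_add_right hf hg₁ hg] at sub_add
  rw [covariance_sub_left hf₁ hf (hg₁.sub hg), covariance_sub_right hf₁ hg₁ hg,
    covariance_sub_right hf hg₁ hg] at sub_sub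
  rw [abs_le]
  constructor <;> linarith

lemma LipschitzWith.monotone_mul_add {K : NNReal} (hf : LipschitzWith K f) :
    Monotone fun x => K * x + f x := by
  intro x y hxy
  have h := hf.dist_le_mul x y
  rw [Real.dist_eq, Real.dist_eq, abs_sub_comm x y, abs_of_nonneg (sub_nonneg.2 hxy)] at h
  linarith [le_abs_self (f x - f y)]

lemma LipschitzWith.monotone_mul_sub {K : NNReal} (hf : LipschitzWith K f) :
    Monotone fun x => K * x - f x := by
  intro x y hxy
  have h := hf.dist_le_mul x y
  rw [Real.dist_eq, Real.dist_eq, abs_sub_comm x y, abs_of_nonneg (sub_nonneg.2 hxy)] at h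
  linarith [neg_abs_le (f x - f y)]

lemma AssociatedPair.abs_covariance_le_of_lipschitz [IsProbabilityMeasure P]
    (h : AssociatedPair P U V) (hU : MemLp U 2 P) (hV : MemLp V 2 P) {K : NNReal}
    (hf : LipschitzWith K f) (hg : LipschitzWith K g)
    (hfU : MemLp (fun ω => f (U ω)) 2 P) (hgV : MemLp (fun ω => g (V ω)) 2 P) :
    |covariance (fun ω => f (U ω)) (fun ω => g (V ω)) P| ≤ K ^ 2 * covariance U V P := by
  refine (h.abs_covariance_le hf.monotone_mul_add hf.monotone_mul_sub hg.monotone_mul_add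
    hg.monotone_mul_sub hfU (hU.const_mul _) hgV (hV.const_mul _)).trans_eq ?_
  rw [covariance_const_mul_left, covariance_const_mul_right]
  ring

lemma lipschitzWith_cos_mul (s : ℝ) : LipschitzWith ‖s‖₊ fun x => Real.cos (s * x) := by
  refine lipschitzWith_of_nnnorm_deriv_le (by fun_prop) fun x => ?_
  have : HasDerivAt (fun x => Real.cos (s * x)) (-Real.sin (s * x) * s) x := by
    simpa using ((hasDerivAt_id x).const_mul s).cos
  rw [this.deriv, ← NNReal.coe_le_coe]
  simpa using mul_le_of_le_one_left (abs_nonneg s) (Real.abs_sin_le_one _)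

lemma lipschitzWith_sin_mul (s : ℝ) : LipschitzWith ‖s‖₊ fun x => Real.sin (s * x) := by
  refine lipschitzWith_of_nnnorm_deriv_le (by fun_prop) fun x => ?_
  have : HasDerivAt (fun x => Real.sin (s * x)) (Real.cos (s * x) * s) x := by
    simpa using ((hasDerivAt_id x).const_mul s).sin
  rw [this.deriv, ← NNReal.coe_le_coe]
  simpa using mul_le_of_le_one_left (abs_nonneg s) (Real.abs_cos_le_one _)

lemma memLp_cos_mul [IsProbabilityMeasure P] (hU : AEMeasurable U P) (s : ℝ) :
    MemLp (fun ω => Real.cos (s * U ω)) 2 P :=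
  .of_bound (by fun_prop) 1 (ae_of_all _ fun _ => Real.abs_cos_le_one _)

lemma memLp_sin_mul [IsProbabilityMeasure P] (hU : AEMeasurable U P) (s : ℝ) :
    MemLp (fun ω => Real.sin (s * U ω)) 2 P :=
  .of_bound (by fun_prop) 1 (ae_of_all _ fun _ => Real.abs_sin_le_one _)

lemma charFun_map_eq_cos_add_sin [IsProbabilityMeasure P] (hU : AEMeasurable U P) (s : ℝ) :
    charFun (P.map U) s =
      (∫ ω, Real.cos (s * U ω) ∂P : ℝ) + (∫ ω, Real.sin (s * U ω) ∂P : ℝ) * Complex.I := by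
  have hc := ((memLp_cos_mul hU s).integrable one_le_two).ofReal (𝕜 := ℂ)
  have hs := ((memLp_sin_mul hU s).integrable one_le_two).ofReal (𝕜 := ℂ)
  rw [charFun_apply_real, integral_map hU (by fun_prop), ← integral_complex_ofReal,
    ← integral_complex_ofReal, ← integral_mul_const]
  refine (integral_congr_ae (ae_of_all _ fun ω => ?_)).trans
    (integral_add hc (hs.mul_const Complex.I))
  simp [Complex.exp_mul_I]

/-- **Newman's inequality** for characteristic functions. -/
lemma AssociatedPair.norm_charFun_add_sub_mul_le [IsProbabilityMeasure P]
    (h : AssociatedPair P U V) (hU : MemLp U 2 P) (hV : MemLp V 2 P) (s : ℝ) :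
    ‖charFun (P.map (U + V)) s - charFun (P.map U) s * charFun (P.map V) s‖ ≤
      4 * s ^ 2 * covariance U V P := by
  have cosU := memLp_cos_mul hU.aemeasurable s
  have sinU := memLp_sin_mul hU.aemeasurable s
  have cosV := memLp_cos_mul hV.aemeasurable s
  have sinV := memLp_sin_mul hV.aemeasurable s
  have cc := h.abs_covariance_le_of_lipschitz hU hV (lipschitzWith_cos_mul s)
    (lipschitzWith_cos_mul s) cosU cosV
  have cs := h.abs_covariance_le_of_lipschitz hU hV (lipschitzWith_cos_mul s)
    (lipschitzWith_sin_mul s) cosU sinV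
  have sc := h.abs_covariance_le_of_lipschitz hU hV (lipschitzWith_sin_mul s)
    (lipschitzWith_cos_mul s) sinU cosV
  have ss := h.abs_covariance_le_of_lipschitz hU hV (lipschitzWith_sin_mul s)
    (lipschitzWith_sin_mul s) sinU sinV
  rw [coe_nnnorm, Real.norm_eq_abs, sq_abs, covariance_eq_cov cosU cosV, cov] at cc
  rw [coe_nnnorm, Real.norm_eq_abs, sq_abs, covariance_eq_cov cosU sinV, cov] at cs
  rw [coe_nnnorm, Real.norm_eq_abs, sq_abs, covariance_eq_cov sinU cosV, cov] at sc
  rw [coe_nnnorm, Real.norm_eq_abs, sq_abs, covariance_eq_cov sinU sinV, cov] at ss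
  have cos_add : ∫ ω, Real.cos (s * (U + V) ω) ∂P =
      (∫ ω, Real.cos (s * U ω) * Real.cos (s * V ω) ∂P) -
        ∫ ω, Real.sin (s * U ω) * Real.sin (s * V ω) ∂P := by
    refine Eq.trans ?_ (integral_sub (cosU.integrable_mul cosV) (sinU.integrable_mul sinV))
    simp only [Pi.add_apply, mul_add, Real.cos_add]
  have sin_add : ∫ ω, Real.sin (s * (U + V) ω) ∂P =
      (∫ ω, Real.sin (s * U ω) * Real.cos (s * V ω) ∂P) +
        ∫ ω, Real.cos (s * U ω) * Real.sin (s * V ω) ∂P := by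
    refine Eq.trans ?_ (integral_add (sinU.integrable_mul cosV) (cosU.integrable_mul sinV))
    simp only [Pi.add_apply, mul_add, Real.sin_add]
  rw [charFun_map_eq_cos_add_sin hU.aemeasurable, charFun_map_eq_cos_add_sin hV.aemeasurable,
    charFun_map_eq_cos_add_sin (hU.add hV).aemeasurable, cos_add, sin_add]
  refine (Complex.norm_le_abs_re_add_abs_im _).trans ?_
  simp only [Complex.sub_re, Complex.sub_im, Complex.add_re, Complex.add_im, Complex.mul_re,
    Complex.mul_im, Complex.ofReal_re, Complex.ofReal_im, Complex.I_re, Complex.I_im]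
  rw [abs_le] at cc cs sc ss
  have key (a b c : ℝ) (ha : |a| ≤ 2 * c) (hb : |b| ≤ 2 * c) : |a| + |b| ≤ 4 * c := by linarith
  rw [mul_assoc]
  apply key <;> rw [abs_le] <;> constructor <;> linarith

end AssociatedPair

section ApproximatelyMultiplicative

lemma norm_pow_sub_pow_le {z w : ℂ} (hz : ‖z‖ ≤ 1) (hw : ‖w‖ ≤ 1) (m : ℕ) :
    ‖z ^ m - w ^ m‖ ≤ m * ‖z - w‖ := by
  induction m with
  | zero => simp
  | succ m ih =>
    have hzm : ‖z ^ m‖ ≤ 1 := by simpa using pow_le_one₀ (norm_nonneg z) hz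
    calc ‖z ^ (m + 1) - w ^ (m + 1)‖
        = ‖z ^ m * (z - w) + (z ^ m - w ^ m) * w‖ := by ring_nf
      _ ≤ ‖z ^ m‖ * ‖z - w‖ + ‖z ^ m - w ^ m‖ * ‖w‖ := by
        simpa only [norm_mul] using norm_add_le (z ^ m * (z - w)) ((z ^ m - w ^ m) * w)
      _ ≤ 1 * ‖z - w‖ + m * ‖z - w‖ * 1 := by gcongr
      _ = (m + 1 : ℕ) * ‖z - w‖ := by push_cast; ring

lemma tendsto_zero_of_forall_le_of_tendsto {a : ℕ → ℝ} {R : ℕ → ℕ → ℝ} {r : ℕ → ℝ}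
    (ha : ∀ n, 0 ≤ a n) (haR : ∀ᶠ l in atTop, ∀ᶠ n in atTop, a n ≤ R l n)
    (hR : ∀ᶠ l in atTop, Tendsto (R l) atTop (𝓝 (r l))) (hr : Tendsto r atTop (𝓝 0)) :
    Tendsto a atTop (𝓝 0) := by
  refine tendsto_order.2 ⟨fun b hb => .of_forall fun n => hb.trans_le (ha n), fun ε hε => ?_⟩
  obtain ⟨l, hl, hRl, hrl⟩ := (haR.and (hR.and (hr.eventually_lt_const hε))).exists
  filter_upwards [hl, hRl.eventually_lt_const hrl] with n h₁ h₂ using h₁.trans_lt h₂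

variable {ψ : ℕ → ℝ → ℂ} {V : ℕ → ℝ}

lemma norm_mul_sub_pow_le (hψ : ∀ k s, ‖ψ k s‖ ≤ 1) (hψ₀ : ∀ s, ψ 0 s = 1) (hV₀ : V 0 = 0)
    (hadd : ∀ a b s, ‖ψ (a + b) s - ψ a s * ψ b s‖ ≤ 2 * s ^ 2 * (V (a + b) - V a - V b))
    (l m : ℕ) (s : ℝ) :
    ‖ψ (l * m) s - ψ l s ^ m‖ ≤ 2 * s ^ 2 * (V (l * m) - m * V l) := by
  induction m with
  | zero => simp [hψ₀, hV₀]
  | succ m ih =>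
    calc ‖ψ (l * m + l) s - ψ l s ^ (m + 1)‖
        = ‖(ψ (l * m + l) s - ψ (l * m) s * ψ l s) +
            (ψ (l * m) s - ψ l s ^ m) * ψ l s‖ := by ring_nf
      _ ≤ ‖ψ (l * m + l) s - ψ (l * m) s * ψ l s‖ +
            ‖ψ (l * m) s - ψ l s ^ m‖ * ‖ψ l s‖ := by
        rw [← norm_mul]; exact norm_add_le _ _
      _ ≤ 2 * s ^ 2 * (V (l * m + l) - V (l * m) - V l) +
            2 * s ^ 2 * (V (l * m) - m * V l) * 1 :=
        add_le_add (hadd _ _ _)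
          (mul_le_mul ih (hψ _ _) (norm_nonneg _) ((norm_nonneg _).trans ih))
      _ = 2 * s ^ 2 * (V (l * m + l) - (m + 1 : ℕ) * V l) := by push_cast; ring

lemma norm_sub_pow_div_le (hψ : ∀ k s, ‖ψ k s‖ ≤ 1) (hψ₀ : ∀ s, ψ 0 s = 1) (hV₀ : V 0 = 0)
    (hV : ∀ k, 0 ≤ V k)
    (hadd : ∀ a b s, ‖ψ (a + b) s - ψ a s * ψ b s‖ ≤ 2 * s ^ 2 * (V (a + b) - V a - V b))
    (l n : ℕ) (s : ℝ) :
    ‖ψ n s - ψ l s ^ (n / l)‖ ≤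
      2 * s ^ 2 * (V n - (n / l : ℕ) * V l) + ‖ψ (n % l) s - 1‖ := by
  have h₁ := norm_mul_sub_pow_le hψ hψ₀ hV₀ hadd l (n / l) s
  have h₂ := hadd (l * (n / l)) (n % l) s
  rw [Nat.div_add_mod] at h₂
  have h₃ : ‖ψ (l * (n / l)) s * (ψ (n % l) s - 1)‖ ≤ ‖ψ (n % l) s - 1‖ := by
    rw [norm_mul]
    exact mul_le_of_le_one_left (norm_nonneg _) (hψ _ _)
  have h₄ : 0 ≤ 2 * s ^ 2 * V (n % l) := by have := hV (n % l); positivity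
  calc ‖ψ n s - ψ l s ^ (n / l)‖
      = ‖(ψ n s - ψ (l * (n / l)) s * ψ (n % l) s) +
          ψ (l * (n / l)) s * (ψ (n % l) s - 1) + (ψ (l * (n / l)) s - ψ l s ^ (n / l))‖ := by
        ring_nf
    _ ≤ _ := by
      refine norm_add₃_le.trans ?_
      linarith

lemma tendsto_natCast_div_mul_sq {l : ℕ} (t : ℝ) :
    Tendsto (fun n : ℕ => ((n / l : ℕ) : ℝ) * ((√n)⁻¹ * t) ^ 2) atTop (𝓝 (t ^ 2 / l)) := by
  have h := ((tendsto_nat_floor_mul_div_atTop (R := ℝ) (a := (l : ℝ)⁻¹) (by positivity)).comp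
    tendsto_natCast_atTop_atTop).mul_const (t ^ 2)
  convert h using 2 with n
  · rw [Function.comp_apply, mul_pow, inv_pow, Real.sq_sqrt n.cast_nonneg, inv_mul_eq_div,
      inv_mul_eq_div, Nat.floor_div_eq_div]
    ring
  · ring

lemma tendsto_inv_sqrt_mul (t : ℝ) : Tendsto (fun n : ℕ => (√n)⁻¹ * t) atTop (𝓝 0) := by
  rw [← zero_mul t]
  exact .mul_const t (tendsto_inv_atTop_zero.comp <| Real.tendsto_sqrt_atTop.comp <|
    tendsto_natCast_atTop_atTop)

lemma isLittleO_sub_exp {φ : ℝ → ℂ} {v : ℝ}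
    (hφ : (fun s : ℝ => φ s - (1 - v * s ^ 2 / 2)) =o[𝓝 0] fun s => s ^ 2) :
    (fun s : ℝ => φ s - Complex.exp (-(v * s ^ 2 / 2 : ℝ))) =o[𝓝 0] fun s => s ^ 2 := by
  have hexp : (fun x : ℂ => Complex.exp x - 1 - x) =o[𝓝 0] fun x => x := by
    simpa [hasDerivAt_iff_isLittleO] using Complex.hasDerivAt_exp 0
  have htend : Tendsto (fun s : ℝ => (-(v * s ^ 2 / 2 : ℝ) : ℂ)) (𝓝 0) (𝓝 0) := by
    have : Continuous fun s : ℝ => (-(v * s ^ 2 / 2 : ℝ) : ℂ) := by fun_prop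
    simpa using this.tendsto 0
  have hO : (fun s : ℝ => (-(v * s ^ 2 / 2 : ℝ) : ℂ)) =O[𝓝 0] fun s => s ^ 2 := by
    refine .of_bound (|v| / 2) (.of_forall fun s => le_of_eq ?_)
    rw [norm_neg, Complex.norm_real, Real.norm_eq_abs, Real.norm_eq_abs, abs_div, abs_mul]
    norm_num
    ring
  refine (hφ.sub ((hexp.comp_tendsto htend).trans_isBigO hO)).congr_left fun s => ?_
  simp only [Function.comp_apply]
  push_cast
  ring

theorem tendsto_exp_of_approximately_multiplicative {σ2 : ℝ}
    (hψ : ∀ k s, ‖ψ k s‖ ≤ 1) (hψ₀ : ∀ s, ψ 0 s = 1) (hV₀ : V 0 = 0) (hV : ∀ k, 0 ≤ V k)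
    (hadd : ∀ a b s, ‖ψ (a + b) s - ψ a s * ψ b s‖ ≤ 2 * s ^ 2 * (V (a + b) - V a - V b))
    (htaylor : ∀ k, (fun s : ℝ => ψ k s - (1 - V k * s ^ 2 / 2)) =o[𝓝 0] fun s => s ^ 2)
    (hlim : Tendsto (fun n : ℕ => V n / n) atTop (𝓝 σ2)) (t : ℝ) :
    Tendsto (fun n : ℕ => ψ n ((√n)⁻¹ * t)) atTop
      (𝓝 (Complex.exp (-(σ2 * t ^ 2 / 2 : ℝ)))) := by
  set E : ℂ := Complex.exp (-(σ2 * t ^ 2 / 2 : ℝ)) with hE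
  let s (n : ℕ) : ℝ := (√n)⁻¹ * t
  let w (l : ℕ) (s : ℝ) : ℂ := Complex.exp (-(V l * s ^ 2 / 2 : ℝ))
  have hw (l : ℕ) (s : ℝ) : ‖w l s‖ ≤ 1 := by
    have := hV l
    simp only [w, ← Complex.ofReal_neg, Complex.norm_exp_ofReal]
    exact Real.exp_le_one_iff.2 (neg_nonpos.2 (by positivity))
  have hs : Tendsto s atTop (𝓝 0) := tendsto_inv_sqrt_mul t
  have hone (k : ℕ) : Tendsto (fun n => ‖ψ k (s n) - 1‖) atTop (𝓝 0) := by
    have hpoly : Tendsto (fun x : ℝ => (1 - V k * x ^ 2 / 2 : ℂ)) (𝓝 0) (𝓝 1) := by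
      have : Continuous fun x : ℝ => (1 - V k * x ^ 2 / 2 : ℂ) := by fun_prop
      simpa using this.tendsto 0
    have hsq : Tendsto (fun x : ℝ => x ^ 2) (𝓝 0) (𝓝 0) := by
      simpa using (continuous_pow 2).tendsto (0 : ℝ)
    have := (((htaylor k).trans_tendsto hsq).add hpoly).comp hs
    rw [← tendsto_iff_norm_sub_tendsto_zero]
    simpa [Function.comp_def] using this
  rw [tendsto_iff_norm_sub_tendsto_zero]
  refine tendsto_zero_of_forall_le_of_tendsto
    (R := fun l n => 2 * s n ^ 2 * (V n - (n / l : ℕ) * V l) +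
      ∑ k ∈ Finset.range l, ‖ψ k (s n) - 1‖ + (n / l : ℕ) * ‖ψ l (s n) - w l (s n)‖ +
      ‖w l (s n) ^ (n / l) - E‖)
    (r := fun l => 2 * t ^ 2 * (σ2 - V l / l) + 0 + 0 +
      ‖Complex.exp (-(V l / l * t ^ 2 / 2 : ℝ)) - E‖)
    (fun n => norm_nonneg _) ?_ ?_ ?_
  · filter_upwards [eventually_gt_atTop 0] with l hl
    refine .of_forall fun n => ?_
    have h₁ := norm_sub_pow_div_le hψ hψ₀ hV₀ hV hadd l n (s n)
    have h₂ := norm_pow_sub_pow_le (hψ l (s n)) (hw l (s n)) (n / l)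
    have h₃ : ‖ψ (n % l) (s n) - 1‖ ≤ ∑ k ∈ Finset.range l, ‖ψ k (s n) - 1‖ :=
      Finset.single_le_sum (f := fun k => ‖ψ k (s n) - 1‖) (fun k _ => norm_nonneg _)
        (Finset.mem_range.2 (Nat.mod_lt n hl))
    calc ‖ψ n (s n) - E‖
        = ‖(ψ n (s n) - ψ l (s n) ^ (n / l)) + (ψ l (s n) ^ (n / l) - w l (s n) ^ (n / l)) +
            (w l (s n) ^ (n / l) - E)‖ := by ring_nf
      _ ≤ _ := by
        refine norm_add₃_le.trans ?_
        linarith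
  · filter_upwards with l
    have hm : Tendsto (fun n => ((n / l : ℕ) : ℝ) * s n ^ 2) atTop (𝓝 (t ^ 2 / l)) :=
      tendsto_natCast_div_mul_sq t
    refine .add (.add (.add ?_ ?_) ?_) ?_
    · have h := ((hlim.const_mul (2 * t ^ 2)).sub (hm.mul_const (2 * V l)))
      convert h using 2 with n
      · have : s n ^ 2 = t ^ 2 / n := by
          simp only [s]
          rw [mul_pow, inv_pow, Real.sq_sqrt n.cast_nonneg, inv_mul_eq_div]
        rw [this]
        ring
      · ring
    · simpa using tendsto_finsetSum (Finset.range l) fun k _ => hone k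
    · have h := ((isLittleO_sub_exp (htaylor l)).comp_tendsto hs).norm_left
      have hmul := (Asymptotics.isBigO_refl (fun n => ((n / l : ℕ) : ℝ)) atTop).mul_isLittleO h
      exact (Asymptotics.isLittleO_one_iff ℝ).1 (hmul.trans_isBigO (hm.isBigO_one ℝ))
    · refine (Tendsto.sub_const ?_ E).norm
      have h : Tendsto (fun n => Complex.exp (-(V l * (((n / l : ℕ) : ℝ) * s n ^ 2) / 2 : ℝ)))
          atTop (𝓝 (Complex.exp (-(V l * (t ^ 2 / l) / 2 : ℝ)))) :=
        (Complex.continuous_exp.comp (continuous_neg.comp Complex.continuous_ofReal)).continuousAt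
          |>.tendsto.comp ((hm.const_mul (V l)).div_const 2)
      convert h using 2 with n
      · simp only [w]
        rw [← Complex.exp_nat_mul]
        congr 1
        push_cast
        ring
      · congr 3
        ring
  · have h₁ := (hlim.const_sub σ2).const_mul (2 * t ^ 2)
    have h₂ : Tendsto (fun l : ℕ => Complex.exp (-(V l / l * t ^ 2 / 2 : ℝ))) atTop (𝓝 E) :=
      (Complex.continuous_exp.comp (continuous_neg.comp Complex.continuous_ofReal)).continuousAt
        |>.tendsto.comp ((hlim.mul_const (t ^ 2)).div_const 2)
    simpa using h₁.add (h₂.sub_const E).norm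

end ApproximatelyMultiplicative

section PartialSums

variable {Ω : Type*} {Y : ℕ → Ω → ℝ}

/-- Increments of the partial sums of `Y` over the window `[a, a + b)`. -/
def windowSum (Y : ℕ → Ω → ℝ) (a b : ℕ) (ω : Ω) : ℝ := ∑ j ∈ Finset.range b, Y (a + j) ω

lemma windowSum_add (a b : ℕ) : windowSum Y 0 (a + b) = windowSum Y 0 a + windowSum Y a b := by
  ext ω
  simp [windowSum, Finset.sum_range_add]

variable [MeasurableSpace Ω] {P : Measure Ω}

lemma memLp_windowSum (hY : ∀ j, MemLp (Y j) 2 P) (a b : ℕ) : MemLp (windowSum Y a b) 2 P :=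
  memLp_finsetSum _ fun _ _ => hY _

lemma isLittleO_charFun_sub_taylor [IsProbabilityMeasure P] {U : Ω → ℝ} (hU : MemLp U 2 P)
    (hmean : ∫ ω, U ω ∂P = 0) :
    (fun s : ℝ => charFun (P.map U) s - (1 - (variance U P : ℝ) * s ^ 2 / 2)) =o[𝓝 0]
      fun s => s ^ 2 := by
  have : IsProbabilityMeasure (P.map U) := Measure.isProbabilityMeasure_map hU.aemeasurable
  have hid : MemLp id 2 (P.map U) := (memLp_map_measure_iff (by fun_prop) hU.aemeasurable).2 hU
  have h := taylor_isLittleO_univ (f := charFun (P.map U)) (x₀ := 0) (n := 2)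
    (contDiff_charFun hid)
  simp_rw [taylorWithinEval_charFun_two_zero hU.aemeasurable hid, hmean] at h
  rw [variance_of_integral_eq_zero hU.aemeasurable hmean]
  simpa using h

variable [IsProbabilityMeasure P]

lemma variance_windowSum_add (hY : ∀ j, MemLp (Y j) 2 P)
    (hstat : ∀ a b, P.map (windowSum Y a b) = P.map (windowSum Y 0 b)) (a b : ℕ) :
    variance (windowSum Y 0 (a + b)) P = variance (windowSum Y 0 a) P +
      2 * covariance (windowSum Y 0 a) (windowSum Y a b) P + variance (windowSum Y 0 b) P := by
  have hvar : variance (windowSum Y a b) P = variance (windowSum Y 0 b) P := by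
    have h : IdentDistrib (windowSum Y a b) (windowSum Y 0 b) P P :=
      ⟨(memLp_windowSum hY a b).aemeasurable, (memLp_windowSum hY 0 b).aemeasurable, hstat a b⟩
    exact h.variance_eq
  rw [windowSum_add, variance_add (memLp_windowSum hY 0 a) (memLp_windowSum hY a b), hvar]

lemma tendsto_variance_windowSum_div (hY : ∀ j, MemLp (Y j) 2 P)
    (hstat : ∀ a b, P.map (windowSum Y a b) = P.map (windowSum Y 0 b))
    {c : ℕ → ℝ} (hcov : ∀ j k, covariance (Y j) (Y (j + k)) P = c k)
    (hsum : Summable fun k => c (k + 1)) :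
    Tendsto (fun n : ℕ => variance (windowSum Y 0 n) P / n) atTop
      (𝓝 (c 0 + 2 * ∑' k, c (k + 1))) := by
  have hone (a : ℕ) : windowSum Y a 1 = Y a := by ext ω; simp [windowSum]
  have hstep (n : ℕ) : variance (windowSum Y 0 (n + 1)) P = variance (windowSum Y 0 n) P +
      (c 0 + 2 * ∑ k ∈ Finset.range n, c (k + 1)) := by
    have hc : covariance (windowSum Y 0 n) (Y n) P = ∑ k ∈ Finset.range n, c (k + 1) := by
      rw [← Finset.sum_range_reflect]
      unfold windowSum
      rw [covariance_fun_sum_left' (fun j _ => hY _) (hY n)]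
      refine Finset.sum_congr rfl fun j hj => ?_
      have hj := Finset.mem_range.1 hj
      rw [← hcov j]
      congr 2 <;> omega
    rw [variance_windowSum_add hY hstat, hone, hone, hc, ← covariance_self (hY 0).aemeasurable,
      ← hcov 0 0]
    ring
  have hsums (n : ℕ) : variance (windowSum Y 0 n) P =
      ∑ i ∈ Finset.range n, (c 0 + 2 * ∑ k ∈ Finset.range i, c (k + 1)) := by
    induction n with
    | zero =>
      have : windowSum Y 0 0 = 0 := by ext ω; simp [windowSum]
      simp [this]
    | succ n ih => rw [hstep, Finset.sum_range_succ, ih]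
  refine ((hsum.hasSum.tendsto_sum_nat.const_mul 2).const_add (c 0)).cesaro.congr fun n => ?_
  rw [hsums, inv_mul_eq_div]

/-- Newman's central limit theorem in terms of characteristic functions. -/
theorem tendsto_charFun_windowSum (hY : ∀ j, MemLp (Y j) 2 P)
    (hmean : ∀ j, ∫ ω, Y j ω ∂P = 0)
    (hstat : ∀ a b, P.map (windowSum Y a b) = P.map (windowSum Y 0 b))
    (hassoc : ∀ a b, AssociatedPair P (windowSum Y 0 a) (windowSum Y a b))
    {c : ℕ → ℝ} (hcov : ∀ j k, covariance (Y j) (Y (j + k)) P = c k)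
    (hsum : Summable fun k => c (k + 1)) (t : ℝ) :
    Tendsto (fun n : ℕ => charFun (P.map (windowSum Y 0 n)) ((√n)⁻¹ * t)) atTop
      (𝓝 (Complex.exp (-((c 0 + 2 * ∑' k, c (k + 1)) * t ^ 2 / 2 : ℝ)))) := by
  have hL2 := memLp_windowSum hY
  have hprob (a b : ℕ) : IsProbabilityMeasure (P.map (windowSum Y a b)) :=
    Measure.isProbabilityMeasure_map (hL2 a b).aemeasurable
  have hzero : windowSum Y 0 0 = fun _ => 0 := by ext ω; simp [windowSum]
  refine tendsto_exp_of_approximately_multiplicative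
    (ψ := fun n => charFun (P.map (windowSum Y 0 n)))
    (V := fun n => variance (windowSum Y 0 n) P)
    (fun k s => norm_charFun_le_one s) (fun s => ?_) (hzero ▸ variance_zero P)
    (fun k => variance_nonneg _ _) (fun a b s => ?_) (fun k => ?_)
    (tendsto_variance_windowSum_div hY hstat hcov hsum) t
  · simp [hzero]
  · have h := (hassoc a b).norm_charFun_add_sub_mul_le (hL2 0 a) (hL2 a b) s
    rw [← windowSum_add, hstat a b] at h
    refine h.trans_eq ?_
    rw [variance_windowSum_add hY hstat]
    ring
  · refine isLittleO_charFun_sub_taylor (hL2 0 k) ?_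
    unfold windowSum
    rw [integral_finsetSum _ fun j _ => (hY _).integrable one_le_two]
    simp [hmean]

end PartialSums

section StationaryAssociated

variable {Ω : Type*} {X : ℤ → Ω → ℝ}

lemma sum_Icc_eq_windowSum (μ : ℝ) (n : ℕ) (ω : Ω) :
    ∑ j ∈ Finset.Icc (1 : ℤ) n, (X j ω - μ) =
      windowSum (fun j ω => X (j + 1) ω - μ) 0 n ω := by
  refine (Finset.sum_bij (fun (j : ℕ) _ => (j : ℤ) + 1) ?_ ?_ ?_ ?_).symm
  · intro j hj
    simp only [Finset.mem_range, Finset.mem_Icc] at hj ⊢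
    omega
  · intro i _ j _ hij
    omega
  · intro j hj
    rw [Finset.mem_Icc] at hj
    exact ⟨(j - 1).toNat, by rw [Finset.mem_range]; omega, by omega⟩
  · intro j _
    simp

variable [MeasurableSpace Ω] {P : Measure Ω}

lemma StrictlyStationary.identDistrib (hstat : StrictlyStationary P X)
    (hmeas : ∀ i, Measurable (X i)) (k : ℤ) {n : ℕ} (t : Fin n → ℤ) :
    IdentDistrib (fun ω j => X (t j + k) ω) (fun ω j => X (t j) ω) P P where
  aemeasurable_fst := by fun_prop
  aemeasurable_snd := by fun_prop
  map_eq := hstat k n t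

lemma StrictlyStationary.identDistrib_zero (hstat : StrictlyStationary P X)
    (hmeas : ∀ i, Measurable (X i)) (i : ℤ) : IdentDistrib (X i) (X 0) P P := by
  simpa [Function.comp_def] using
    (hstat.identDistrib hmeas i fun _ : Fin 1 => 0).comp (measurable_pi_apply 0)

lemma StrictlyStationary.cov_add (hstat : StrictlyStationary P X)
    (hmeas : ∀ i, Measurable (X i)) (i k : ℤ) : cov P (X i) (X (i + k)) = cov P (X 0) (X k) := by
  have h : IdentDistrib (fun ω => X i ω * X (i + k) ω) (fun ω => X 0 ω * X k ω) P P := by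
    simpa [Function.comp_def, add_comm k] using
      (hstat.identDistrib hmeas i ![0, k]).comp
        (show Measurable fun x : Fin 2 → ℝ => x 0 * x 1 by fun_prop)
  rw [cov, cov, h.integral_eq, (hstat.identDistrib_zero hmeas i).integral_eq,
    (hstat.identDistrib_zero hmeas (i + k)).integral_eq,
    (hstat.identDistrib_zero hmeas k).integral_eq]

lemma StrictlyStationary.map_windowSum (hstat : StrictlyStationary P X)
    (hmeas : ∀ i, Measurable (X i)) (μ : ℝ) (a b : ℕ) :
    P.map (windowSum (fun j ω => X (j + 1) ω - μ) a b) =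
      P.map (windowSum (fun j ω => X (j + 1) ω - μ) 0 b) := by
  have h := ((hstat.identDistrib hmeas a fun j : Fin b => (j : ℤ) + 1).comp
    (show Measurable fun x : Fin b → ℝ => ∑ j, (x j - μ) by fun_prop)).map_eq
  convert h using 2
  · ext ω
    simp only [windowSum, Finset.sum_range, Function.comp_apply]
    refine Finset.sum_congr rfl fun j _ => ?_
    congr 2
    push_cast
    ring
  · ext ω
    simp [windowSum, Finset.sum_range]

lemma AssociatedFamily.associatedPair_windowSum (hassoc : AssociatedFamily P X) (μ : ℝ)
    (a b : ℕ) :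
    AssociatedPair P (windowSum (fun j ω => X (j + 1) ω - μ) 0 a)
      (windowSum (fun j ω => X (j + 1) ω - μ) a b) := by
  rintro f g hf hg ⟨M, hM⟩ ⟨N, hN⟩
  have h := hassoc (a + b) (fun j => (j : ℤ) + 1)
    (fun x => f (∑ i, (x (Fin.castAdd b i) - μ))) (fun x => g (∑ i, (x (Fin.natAdd a i) - μ)))
    (hf.measurable.comp (by fun_prop)) (hg.measurable.comp (by fun_prop))
    ⟨M, fun _ => hM _⟩ ⟨N, fun _ => hN _⟩
    (fun x y hxy => hf (Finset.sum_le_sum fun i _ => sub_le_sub_right (hxy _) μ))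
    (fun x y hxy => hg (Finset.sum_le_sum fun i _ => sub_le_sub_right (hxy _) μ))
  simpa [windowSum, Finset.sum_range] using h

end StationaryAssociated

lemma tendsto_integral_boundedContinuous_of_tendsto_charFun {Ω : Type*} [MeasurableSpace Ω]
    {P : Measure Ω} [IsProbabilityMeasure P] {Z : ℕ → Ω → ℝ} (hZ : ∀ n, AEMeasurable (Z n) P)
    {ν : Measure ℝ} [IsProbabilityMeasure ν]
    (h : ∀ t, Tendsto (fun n => charFun (P.map (Z n)) t) atTop (𝓝 (charFun ν t)))
    (g : BoundedContinuousFunction ℝ ℝ) :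
    Tendsto (fun n => ∫ ω, g (Z n ω) ∂P) atTop (𝓝 (∫ x, g x ∂ν)) := by
  let law (n : ℕ) : ProbabilityMeasure ℝ := ⟨P.map (Z n), Measure.isProbabilityMeasure_map (hZ n)⟩
  have hlaw : Tendsto law atTop (𝓝 ⟨ν, inferInstance⟩) :=
    ProbabilityMeasure.tendsto_of_tendsto_charFun h
  refine (ProbabilityMeasure.tendsto_iff_forall_integral_tendsto.1 hlaw g).congr fun n => ?_
  exact integral_map (hZ n) g.continuous.aestronglyMeasurable

/-- **Newman's central limit theorem for associated sequences.** If `(X_n)_{n ∈ ℤ}` is a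
strictly stationary associated sequence with `E[X₀²] < ∞` and
`σ² = Var(X₀) + 2 Σ_{k≥1} Cov(X₀, X_k)` finite and strictly positive, then
`n^{−1/2} Σ_{j=1}^n (X_j − E[X₀])` converges in distribution to a centered Gaussian with
variance `σ²`. -/
theorem newman_clt_associated {Ω : Type*} [MeasurableSpace Ω]
    (P : Measure Ω) [IsProbabilityMeasure P]
    (X : ℤ → Ω → ℝ) (hmeas : ∀ i, Measurable (X i))
    (hstat : StrictlyStationary P X)
    (hassoc : AssociatedFamily P X)
    (hL2 : Integrable (fun ω => (X 0 ω) ^ 2) P)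
    (hsummable : Summable fun k : ℕ => cov P (X 0) (X ((k : ℤ) + 1)))
    (σ2 : ℝ)
    (hσ2 : σ2 = cov P (X 0) (X 0) + 2 * ∑' k : ℕ, cov P (X 0) (X ((k : ℤ) + 1)))
    (hpos : 0 < σ2) :
    ∀ g : BoundedContinuousFunction ℝ ℝ,
      Tendsto
        (fun n : ℕ => ∫ ω,
          g ((n : ℝ) ^ (-(1 : ℝ) / 2)
              * ∑ j ∈ Finset.Icc (1 : ℤ) (n : ℤ), (X j ω - ∫ ω', X 0 ω' ∂P)) ∂P)
        atTop
        (𝓝 (∫ x, g x ∂(ProbabilityTheory.gaussianReal 0 σ2.toNNReal))) := by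
  intro g
  have hident := hstat.identDistrib_zero hmeas
  have hL2X (i : ℤ) : MemLp (X i) 2 P :=
    (hident i).memLp_iff.2 ((memLp_two_iff_integrable_sq (hmeas 0).aestronglyMeasurable).2 hL2)
  set μ := ∫ ω, X 0 ω ∂P with hμ
  let Y (j : ℕ) (ω : Ω) : ℝ := X (j + 1) ω - μ
  let c (k : ℕ) : ℝ := cov P (X 0) (X k)
  have hY (j : ℕ) : MemLp (Y j) 2 P := (hL2X _).sub (memLp_const μ)
  have hmean (j : ℕ) : ∫ ω, Y j ω ∂P = 0 := by
    rw [integral_sub ((hL2X _).integrable one_le_two) (integrable_const μ),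
      (hident _).integral_eq, integral_const, probReal_univ, one_smul, hμ, sub_self]
  have hcov (j k : ℕ) : covariance (Y j) (Y (j + k)) P = c k := by
    have hXint (i : ℤ) := (hL2X i).integrable one_le_two
    rw [covariance_sub_const_left (hXint _), covariance_sub_const_right (hXint _),
      covariance_eq_cov (hL2X _) (hL2X _)]
    convert hstat.cov_add hmeas (j + 1) k using 3
    push_cast
    ring
  have hc : σ2 = c 0 + 2 * ∑' k, c (k + 1) := by simpa [c] using hσ2
  have hchar := tendsto_charFun_windowSum hY hmean (hstat.map_windowSum hmeas μ)
    (hassoc.associatedPair_windowSum μ) hcov (by simpa [c] using hsummable)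
  have hmeasS (n : ℕ) : AEMeasurable (windowSum Y 0 n) P := (memLp_windowSum hY 0 n).aemeasurable
  refine (tendsto_integral_boundedContinuous_of_tendsto_charFun
    (Z := fun n ω => (√n)⁻¹ * windowSum Y 0 n ω) (fun n => (hmeasS n).const_mul _)
    (fun t => ?_) g).congr fun n => ?_
  · simp_rw [charFun_map_mul_comp (hmeasS _)]
    convert hchar t using 2
    rw [charFun_gaussianReal, ← hc, Real.coe_toNNReal _ hpos.le]
    congr 1
    push_cast
    ring
  · rw [neg_div, Real.rpow_neg n.cast_nonneg, ← Real.sqrt_eq_rpow]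
    simp_rw [sum_Icc_eq_windowSum]
    rfl

end
end

section
/- (Ellis–Newman / Simon–Griffiths, non-Gaussian limit at the Curie–Weiss critical point) For n ≥ 1 let P_n be the probability measure on {−1,+1}^n given by P_n(σ) = Z_n^{−1} exp((1/(2n)) (Σ_{i=1}^n σ_i)²), where Z_n is the normalizing constant, and let S_n(σ) = Σ_{i=1}^n σ_i. Then S_n / n^{3/4} converges in distribution, as n → ∞, to the probability measure on ℝ with density C exp(−x⁴/12), where C = (∫_ℝ exp(−x⁴/12) dx)^{−1}. In particular the limit is non-Gaussian. -/
open MeasureTheory Filter Topology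

noncomputable section

/-- The spin value of a Boolean: `+1` or `−1`. -/
def spin (b : Bool) : ℝ := if b then 1 else -1

/-- The total spin `S_n(σ) = Σ_{i=1}^n σ_i` of a configuration of `n` spins. -/
def totalSpin (n : ℕ) (σ : Fin n → Bool) : ℝ := ∑ i, spin (σ i)

/-- The Curie–Weiss Boltzmann weight `exp((Σ_i σ_i)² / (2n))` at inverse temperature `β = 1`. -/
def cwWeight (n : ℕ) (σ : Fin n → Bool) : ℝ :=
  Real.exp (totalSpin n σ ^ 2 / (2 * n))

/-- The Curie–Weiss partition function `Z_n`. -/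
def cwZ (n : ℕ) : ℝ := ∑ σ : Fin n → Bool, cwWeight n σ


lemma nonneg_of_hasDerivAt_nonneg {f f' : ℝ → ℝ} (hf : ∀ t, HasDerivAt f (f' t) t)
    (h0 : f 0 = 0) (hf' : ∀ t, 0 ≤ t → 0 ≤ f' t) {t : ℝ} (ht : 0 ≤ t) : 0 ≤ f t := by
  have hmono : MonotoneOn f (Set.Ici 0) := by
    refine monotoneOn_of_deriv_nonneg (convex_Ici 0)
      (fun x _ => (hf x).continuousAt.continuousWithinAt)
      (fun x _ => (hf x).differentiableAt.differentiableWithinAt) fun x hx => ?_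
    rw [(hf x).deriv]
    exact hf' x (interior_subset hx)
  simpa [h0] using hmono Set.self_mem_Ici ht ht

lemma sinh_le_mul_cosh {t : ℝ} (ht : 0 ≤ t) : Real.sinh t ≤ t * Real.cosh t := by
  have key := nonneg_of_hasDerivAt_nonneg
    (f := fun t => t * Real.cosh t - Real.sinh t) (f' := fun t => t * Real.sinh t)
    (fun t => by
      refine HasDerivAt.congr_deriv (((hasDerivAt_id t).mul (Real.hasDerivAt_cosh t)).sub (Real.hasDerivAt_sinh t)) ?_
      simp)
    (by simp) (fun t ht => mul_nonneg ht (Real.sinh_nonneg_iff.2 ht)) ht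
  linarith

lemma sub_cube_mul_cosh_le_sinh {t : ℝ} (ht : 0 ≤ t) :
    (t - t ^ 3 / 3) * Real.cosh t ≤ Real.sinh t := by
  have key := nonneg_of_hasDerivAt_nonneg
    (f := fun t => Real.sinh t - (t - t ^ 3 / 3) * Real.cosh t)
    (f' := fun t => t * (t * Real.cosh t - Real.sinh t) + t ^ 3 / 3 * Real.sinh t)
    (fun t => by
      refine HasDerivAt.congr_deriv ((Real.hasDerivAt_sinh t).sub
        (((hasDerivAt_id t).sub ((hasDerivAt_pow 3 t).div_const 3)).mul
          (Real.hasDerivAt_cosh t))) ?_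
      simp
      ring)
    (by simp)
    (fun t ht => by
      have := sinh_le_mul_cosh ht
      have := Real.sinh_nonneg_iff.2 ht
      have := mul_nonneg ht (sub_nonneg.2 (sinh_le_mul_cosh ht))
      positivity) ht
  linarith

lemma one_add_sq_mul_sinh_le {t : ℝ} (ht : 0 ≤ t) :
    (1 + t ^ 2) * Real.sinh t ≤ (t + 2 / 3 * t ^ 3) * Real.cosh t := by
  have key := nonneg_of_hasDerivAt_nonneg
    (f := fun t => (t + 2 / 3 * t ^ 3) * Real.cosh t - (1 + t ^ 2) * Real.sinh t)
    (f' := fun t => t * (t * Real.cosh t - Real.sinh t) + 2 / 3 * t ^ 3 * Real.sinh t)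
    (fun t => by
      refine HasDerivAt.congr_deriv ((((hasDerivAt_id t).add ((hasDerivAt_pow 3 t).const_mul (2 / 3))).mul
          (Real.hasDerivAt_cosh t)).sub
        (((hasDerivAt_pow 2 t).const_add 1).mul (Real.hasDerivAt_sinh t))) ?_
      simp
      ring)
    (by simp)
    (fun t ht => by
      have := Real.sinh_nonneg_iff.2 ht
      have := mul_nonneg ht (sub_nonneg.2 (sinh_le_mul_cosh ht))
      have : 0 ≤ 2 / 3 * t ^ 3 * Real.sinh t := by positivity
      linarith) ht
  linarith

/-- The single-spin factor after linearising the square of the total spin. -/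
def spinFactor (t : ℝ) : ℝ := Real.exp (-t ^ 2 / 2) * Real.cosh t

lemma spinFactor_neg (t : ℝ) : spinFactor (-t) = spinFactor t := by simp [spinFactor]

lemma exp_neg_fourth_le_spinFactor (t : ℝ) : Real.exp (-t ^ 4 / 12) ≤ spinFactor t := by
  wlog ht : 0 ≤ t generalizing t
  · simpa [spinFactor_neg, Even.neg_pow (show Even 4 by decide)] using this (-t) (by linarith)
  have key := nonneg_of_hasDerivAt_nonneg
    (f := fun t => Real.exp (-t ^ 2 / 2 + t ^ 4 / 12) * Real.cosh t - 1)
    (f' := fun t => Real.exp (-t ^ 2 / 2 + t ^ 4 / 12) *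
      (Real.sinh t - (t - t ^ 3 / 3) * Real.cosh t))
    (fun t => by
      refine HasDerivAt.congr_deriv ((((((hasDerivAt_pow 2 t).neg.div_const 2).add
        ((hasDerivAt_pow 4 t).div_const 12)).exp).mul (Real.hasDerivAt_cosh t)).sub_const 1) ?_
      simp
      ring)
    (by simp)
    (fun t ht => mul_nonneg (Real.exp_pos _).le (sub_nonneg.2 (sub_cube_mul_cosh_le_sinh ht))) ht
  have h : spinFactor t = Real.exp (-t ^ 4 / 12) *
      (Real.exp (-t ^ 2 / 2 + t ^ 4 / 12) * Real.cosh t) := by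
    rw [spinFactor, ← mul_assoc, ← Real.exp_add]
    congr 2
    ring
  rw [h]
  exact le_mul_of_one_le_right (Real.exp_pos _).le (by linarith)

lemma spinFactor_le_exp (t : ℝ) :
    spinFactor t ≤ Real.exp (-(t ^ 4 / (12 * (1 + t ^ 2)))) := by
  wlog ht : 0 ≤ t generalizing t
  · simpa [spinFactor_neg, Even.neg_pow (show Even 4 by decide)] using this (-t) (by linarith)
  have key := nonneg_of_hasDerivAt_nonneg
    (f := fun t => 1 - Real.exp (-t ^ 2 / 2 + t ^ 4 / (12 * (1 + t ^ 2))) * Real.cosh t)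
    (f' := fun t => Real.exp (-t ^ 2 / 2 + t ^ 4 / (12 * (1 + t ^ 2))) *
      (((t + 2 / 3 * t ^ 3) * Real.cosh t - (1 + t ^ 2) * Real.sinh t) / (1 + t ^ 2)
        + t ^ 5 / (6 * (1 + t ^ 2) ^ 2) * Real.cosh t))
    (fun t => by
      have hpos : 1 + t ^ 2 ≠ 0 := by positivity
      refine HasDerivAt.congr_deriv (((((((hasDerivAt_pow 2 t).neg.div_const 2).add
        ((hasDerivAt_pow 4 t).div (((hasDerivAt_pow 2 t).const_add 1).const_mul 12)
          (by positivity))).exp).mul (Real.hasDerivAt_cosh t)).const_sub 1)) ?_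
      simp
      field_simp
      ring)
    (by simp)
    (fun t ht => by
      have := sub_nonneg.2 (one_add_sq_mul_sinh_le ht)
      have := (Real.cosh_pos t).le
      positivity) ht
  have h : spinFactor t = Real.exp (-(t ^ 4 / (12 * (1 + t ^ 2)))) *
      (Real.exp (-t ^ 2 / 2 + t ^ 4 / (12 * (1 + t ^ 2))) * Real.cosh t) := by
    rw [spinFactor, ← mul_assoc, ← Real.exp_add]
    congr 2
    ring
  rw [h]
  exact mul_le_of_le_one_right (Real.exp_pos _).le (by linarith)

lemma spinFactor_nonneg (t : ℝ) : 0 ≤ spinFactor t :=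
  mul_nonneg (Real.exp_pos _).le (Real.cosh_pos t).le

lemma continuous_spinFactor : Continuous spinFactor := by
  unfold spinFactor
  exact (by fun_prop : Continuous fun t : ℝ => Real.exp (-t ^ 2 / 2)).mul Real.continuous_cosh

lemma exp_neg_fourth_le_spinFactor_pow {n : ℕ} {a : ℝ} (hna : n * a ^ 4 = 1) (x : ℝ) :
    Real.exp (-x ^ 4 / 12) ≤ spinFactor (a * x) ^ n := by
  calc Real.exp (-x ^ 4 / 12) = Real.exp (-(a * x) ^ 4 / 12) ^ n := by
        rw [← Real.exp_nat_mul]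
        congr 1
        linear_combination (x ^ 4 / 12) * hna
    _ ≤ _ := pow_le_pow_left₀ (Real.exp_pos _).le (exp_neg_fourth_le_spinFactor _) n

lemma spinFactor_pow_le_exp {n : ℕ} {a : ℝ} (hna : n * a ^ 4 = 1) (x : ℝ) :
    spinFactor (a * x) ^ n ≤ Real.exp (-(x ^ 4 / (12 * (1 + (a * x) ^ 2)))) := by
  calc spinFactor (a * x) ^ n
      ≤ Real.exp (-((a * x) ^ 4 / (12 * (1 + (a * x) ^ 2)))) ^ n :=
        pow_le_pow_left₀ (spinFactor_nonneg _) (spinFactor_le_exp _) n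
    _ = _ := by
        rw [← Real.exp_nat_mul]
        congr 1
        linear_combination (-(x ^ 4 / (12 * (1 + (a * x) ^ 2)))) * hna

lemma spinFactor_pow_le_gaussian {n : ℕ} {a : ℝ} (ha : 0 ≤ a) (ha1 : a ≤ 1)
    (hna : n * a ^ 4 = 1) (x : ℝ) :
    spinFactor (a * x) ^ n ≤ Real.exp (1 / 12) * Real.exp (-(1 / 12) * x ^ 2) := by
  refine (spinFactor_pow_le_exp hna x).trans ?_
  rw [← Real.exp_add, Real.exp_le_exp]
  have h1 : (a * x) ^ 2 ≤ x ^ 2 := by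
    rw [mul_pow]
    exact mul_le_of_le_one_left (sq_nonneg x) (pow_le_one₀ ha ha1)
  have h2 : (x ^ 2 - 1) / 12 ≤ x ^ 4 / (12 * (1 + (a * x) ^ 2)) := by
    rw [div_le_div_iff₀ (by norm_num) (by positivity)]
    nlinarith [sq_nonneg (x ^ 2), sq_nonneg (a * x), mul_nonneg (sq_nonneg x) (sub_nonneg.2 h1)]
  linarith

/-- The scale `n^{-1/4}`. -/
def quarterScale (n : ℕ) : ℝ := ((n : ℝ) ^ ((1 : ℝ) / 4))⁻¹

lemma quarterScale_pos {n : ℕ} (hn : 1 ≤ n) : 0 < quarterScale n := by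
  have : (0 : ℝ) < n := by exact_mod_cast hn
  unfold quarterScale
  positivity

lemma quarterScale_le_one {n : ℕ} (hn : 1 ≤ n) : quarterScale n ≤ 1 :=
  inv_le_one_of_one_le₀ (Real.one_le_rpow (by exact_mod_cast hn) (by norm_num))

lemma natCast_mul_quarterScale_pow_four {n : ℕ} (hn : 1 ≤ n) : n * quarterScale n ^ 4 = 1 := by
  have h : (n : ℝ) ≠ 0 := by positivity
  rw [quarterScale, inv_pow, ← Real.rpow_mul_natCast (Nat.cast_nonneg n)]
  norm_num [h]

lemma div_rpow_eq_mul_quarterScale (n : ℕ) (s : ℝ) :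
    s / (n : ℝ) ^ ((3 : ℝ) / 4) = s * quarterScale n ^ 3 := by
  rw [quarterScale, inv_pow, ← Real.rpow_mul_natCast (Nat.cast_nonneg n), div_eq_mul_inv]
  norm_num

lemma tendsto_quarterScale : Tendsto quarterScale atTop (𝓝 0) :=
  ((tendsto_rpow_atTop (by norm_num)).comp tendsto_natCast_atTop_atTop).inv_tendsto_atTop

lemma tendsto_spinFactor_pow (x : ℝ) :
    Tendsto (fun n : ℕ => spinFactor (quarterScale n * x) ^ n) atTop
      (𝓝 (Real.exp (-x ^ 4 / 12))) := by
  have hupper : Tendsto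
      (fun n : ℕ => Real.exp (-(x ^ 4 / (12 * (1 + (quarterScale n * x) ^ 2))))) atTop
      (𝓝 (Real.exp (-x ^ 4 / 12))) := by
    have hc : ContinuousAt (fun a : ℝ => Real.exp (-(x ^ 4 / (12 * (1 + (a * x) ^ 2))))) 0 := by
      refine Continuous.continuousAt ?_
      refine Real.continuous_exp.comp (Continuous.neg (Continuous.div (by fun_prop) (by fun_prop)
        fun a => ?_))
      positivity
    have := hc.tendsto.comp tendsto_quarterScale
    convert this using 2
    simp
    ring_nf
  refine tendsto_of_tendsto_of_tendsto_of_le_of_le' tendsto_const_nhds hupper ?_ ?_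
  · filter_upwards [eventually_ge_atTop 1] with n hn using
      exp_neg_fourth_le_spinFactor_pow (natCast_mul_quarterScale_pow_four hn) x
  · filter_upwards [eventually_ge_atTop 1] with n hn using
      spinFactor_pow_le_exp (natCast_mul_quarterScale_pow_four hn) x

lemma integrable_gaussian_bound :
    Integrable fun x : ℝ => Real.exp (1 / 12) * Real.exp (-(1 / 12) * x ^ 2) :=
  (integrable_exp_neg_mul_sq (by norm_num)).const_mul _

lemma integrable_exp_neg_fourth : Integrable fun x : ℝ => Real.exp (-x ^ 4 / 12) := by
  refine integrable_gaussian_bound.mono' (by fun_prop) (.of_forall fun x => ?_)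
  rw [Real.norm_of_nonneg (Real.exp_pos _).le]
  exact (exp_neg_fourth_le_spinFactor_pow (n := 1) (a := 1) (by norm_num) x).trans
    (spinFactor_pow_le_gaussian zero_le_one le_rfl (by norm_num) x)

lemma integral_exp_neg_fourth_pos : 0 < ∫ x : ℝ, Real.exp (-x ^ 4 / 12) :=
  integral_exp_pos integrable_exp_neg_fourth

lemma tendsto_integral_mul_spinFactor_pow (g : BoundedContinuousFunction ℝ ℝ) :
    Tendsto (fun n : ℕ => ∫ x : ℝ, g x * spinFactor (quarterScale n * x) ^ n) atTop
      (𝓝 (∫ x : ℝ, g x * Real.exp (-x ^ 4 / 12))) := by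
  refine tendsto_integral_filter_of_dominated_convergence
    (fun x => ‖g‖ * (Real.exp (1 / 12) * Real.exp (-(1 / 12) * x ^ 2))) ?_ ?_
    (integrable_gaussian_bound.const_mul _) ?_
  · exact .of_forall fun n => Continuous.aestronglyMeasurable
      (g.continuous.mul ((continuous_spinFactor.comp (continuous_const.mul continuous_id)).pow n))
  · filter_upwards [eventually_ge_atTop 1] with n hn
    refine .of_forall fun x => ?_
    rw [norm_mul, Real.norm_of_nonneg (pow_nonneg (spinFactor_nonneg _) n)]
    exact mul_le_mul (g.norm_coe_le_norm x) (spinFactor_pow_le_gaussian (quarterScale_pos hn).le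
      (quarterScale_le_one hn) (natCast_mul_quarterScale_pow_four hn) x)
      (pow_nonneg (spinFactor_nonneg _) n) (norm_nonneg g)
  · exact .of_forall fun x => (tendsto_spinFactor_pow x).const_mul (g x)

lemma integrable_exp_neg_sq_div_two : Integrable fun z : ℝ => Real.exp (-z ^ 2 / 2) := by
  convert integrable_exp_neg_mul_sq (b := 1 / 2) (by norm_num) using 3
  ring

lemma integrable_abs_mul_exp_neg_sq_div_two :
    Integrable fun z : ℝ => |z| * Real.exp (-z ^ 2 / 2) := by
  convert (integrable_mul_exp_neg_mul_sq (b := 1 / 2) (by norm_num)).norm using 2 with z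
  rw [norm_mul, Real.norm_of_nonneg (Real.exp_pos _).le, Real.norm_eq_abs]
  congr 2
  ring

lemma integrable_boundedContinuous_mul (g : BoundedContinuousFunction ℝ ℝ) {h : ℝ → ℝ}
    (hh : Integrable h) : Integrable fun x => g x * h x :=
  hh.bdd_mul g.continuous.aestronglyMeasurable (.of_forall g.norm_coe_le_norm)

lemma integral_comp_affine (h : ℝ → ℝ) {a : ℝ} (ha : 0 < a) (c : ℝ) :
    ∫ z, h (a * z + c) = a⁻¹ * ∫ x, h x := by
  rw [Measure.integral_comp_mul_left (fun y => h (y + c)) a, integral_add_right_eq_self h c,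
    abs_of_pos (inv_pos.2 ha), smul_eq_mul]

lemma sum_exp_mul_totalSpin (n : ℕ) (t : ℝ) :
    ∑ σ : Fin n → Bool, Real.exp (t * totalSpin n σ) = (2 * Real.cosh t) ^ n := by
  have h : ∀ σ : Fin n → Bool, Real.exp (t * totalSpin n σ) = ∏ i, Real.exp (t * spin (σ i)) := by
    intro σ
    rw [totalSpin, Finset.mul_sum, Real.exp_sum]
  have h2 := Finset.prod_univ_sum (fun _ : Fin n => (Finset.univ : Finset Bool))
    (fun _ b => Real.exp (t * spin b))
  rw [Fintype.piFinset_univ] at h2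
  simp_rw [h]
  rw [← h2]
  simp [spin, Real.cosh_eq]
  congr 1
  ring

lemma cwWeight_eq {n : ℕ} {a : ℝ} (hna : n * a ^ 4 = 1) (σ : Fin n → Bool) :
    cwWeight n σ = Real.exp (totalSpin n σ ^ 2 * a ^ 4 / 2) := by
  have hn : (n : ℝ) ≠ 0 := left_ne_zero_of_mul_eq_one hna
  rw [cwWeight]
  congr 1
  field_simp
  linear_combination (-totalSpin n σ ^ 2) * hna

/-- Hubbard–Stratonovich: completing the square in the Gaussian smoothing of one configuration. -/
lemma exp_mul_gaussian_eq {a : ℝ} (ha : 0 < a) (s x : ℝ) :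
    Real.exp (s ^ 2 * a ^ 4 / 2) * Real.exp (-((x - s * a ^ 3) / a) ^ 2 / 2) =
      Real.exp (-(x / a) ^ 2 / 2) * Real.exp (a * x * s) := by
  rw [← Real.exp_add, ← Real.exp_add]
  congr 1
  field_simp
  ring

lemma exp_mul_integral_smoothed_eq (g : ℝ → ℝ) {a : ℝ} (ha : 0 < a) (s : ℝ) :
    Real.exp (s ^ 2 * a ^ 4 / 2) * ∫ z, g (a * z + s * a ^ 3) * Real.exp (-z ^ 2 / 2) =
      a⁻¹ * ∫ x, g x * (Real.exp (-(x / a) ^ 2 / 2) * Real.exp (a * x * s)) := by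
  have h := integral_comp_affine
    (fun x => g x * Real.exp (-((x - s * a ^ 3) / a) ^ 2 / 2)) ha (s * a ^ 3)
  simp only [add_sub_cancel_right, mul_div_cancel_left₀ _ ha.ne'] at h
  rw [h, mul_left_comm, ← integral_const_mul]
  congr 2 with x
  rw [mul_left_comm, exp_mul_gaussian_eq ha]

lemma integrable_exp_neg_sq_mul_exp {a : ℝ} (ha : 0 < a) (s : ℝ) :
    Integrable fun x : ℝ => Real.exp (-(x / a) ^ 2 / 2) * Real.exp (a * x * s) := by
  simp_rw [← exp_mul_gaussian_eq ha s]
  exact ((integrable_exp_neg_sq_div_two.comp_div ha.ne').comp_sub_right (s * a ^ 3)).const_mul _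

lemma sum_cwWeight_mul_smoothed {n : ℕ} {a : ℝ} (ha : 0 < a) (hna : n * a ^ 4 = 1)
    (g : BoundedContinuousFunction ℝ ℝ) :
    ∑ σ : Fin n → Bool, cwWeight n σ *
        ∫ z, g (a * z + totalSpin n σ * a ^ 3) * Real.exp (-z ^ 2 / 2) =
      a⁻¹ * 2 ^ n * ∫ x, g x * spinFactor (a * x) ^ n := by
  simp_rw [cwWeight_eq hna, exp_mul_integral_smoothed_eq g ha]
  rw [← Finset.mul_sum, ← integral_finsetSum _ fun σ _ =>
    integrable_boundedContinuous_mul g (integrable_exp_neg_sq_mul_exp ha _), mul_assoc,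
    ← integral_const_mul (2 ^ n : ℝ)]
  congr 2 with x
  rw [← Finset.mul_sum, ← Finset.mul_sum, sum_exp_mul_totalSpin, spinFactor, mul_pow, mul_pow,
    ← Real.exp_nat_mul]
  have h : -(x / a) ^ 2 / 2 = n * (-(a * x) ^ 2 / 2) := by
    field_simp
    linear_combination x ^ 2 * hna
  rw [h]
  ring

lemma cwZ_pos (n : ℕ) : 0 < cwZ n :=
  Finset.sum_pos (fun _ _ => Real.exp_pos _) Finset.univ_nonempty

lemma cwZ_mul_integral {n : ℕ} {a : ℝ} (ha : 0 < a) (hna : n * a ^ 4 = 1) :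
    cwZ n * ∫ z : ℝ, Real.exp (-z ^ 2 / 2) = a⁻¹ * 2 ^ n * ∫ x, spinFactor (a * x) ^ n := by
  simpa [cwZ, Finset.sum_mul] using
    sum_cwWeight_mul_smoothed ha hna (BoundedContinuousFunction.const ℝ 1)

lemma abs_mul_integral_sub_smoothed_le (g : BoundedContinuousFunction ℝ ℝ) {L : NNReal}
    (hL : LipschitzWith L g) {a : ℝ} (ha : 0 < a) (y : ℝ) :
    |g y * (∫ z : ℝ, Real.exp (-z ^ 2 / 2)) - ∫ z, g (a * z + y) * Real.exp (-z ^ 2 / 2)| ≤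
      L * a * ∫ z : ℝ, |z| * Real.exp (-z ^ 2 / 2) := by
  have hint : Integrable fun z => g (a * z + y) * Real.exp (-z ^ 2 / 2) :=
    integrable_boundedContinuous_mul
      (g.compContinuous ⟨fun z => a * z + y, by fun_prop⟩) integrable_exp_neg_sq_div_two
  rw [← integral_const_mul, ← integral_sub (integrable_exp_neg_sq_div_two.const_mul _) hint,
    ← integral_const_mul, ← Real.norm_eq_abs]
  refine norm_integral_le_of_norm_le (integrable_abs_mul_exp_neg_sq_div_two.const_mul _)
    (.of_forall fun z => ?_)
  have h := hL.dist_le_mul y (a * z + y)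
  rw [Real.dist_eq, Real.dist_eq, sub_add_cancel_right, abs_neg, abs_mul, abs_of_pos ha] at h
  rw [← sub_mul, norm_mul, Real.norm_of_nonneg (Real.exp_pos _).le, Real.norm_eq_abs, ← mul_assoc]
  refine mul_le_mul_of_nonneg_right (h.trans_eq ?_) (Real.exp_pos _).le
  ring

lemma abs_cwExpectation_sub_le {n : ℕ} {a : ℝ} (ha : 0 < a) (hna : n * a ^ 4 = 1)
    (g : BoundedContinuousFunction ℝ ℝ) {L : NNReal} (hL : LipschitzWith L g) :
    |(∑ σ : Fin n → Bool, cwWeight n σ * g (totalSpin n σ * a ^ 3)) / cwZ n -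
        (∫ x, g x * spinFactor (a * x) ^ n) / ∫ x, spinFactor (a * x) ^ n| ≤
      L * a * ((∫ z : ℝ, |z| * Real.exp (-z ^ 2 / 2)) / ∫ z : ℝ, Real.exp (-z ^ 2 / 2)) := by
  set G := ∫ z : ℝ, Real.exp (-z ^ 2 / 2)
  set M := ∫ z : ℝ, |z| * Real.exp (-z ^ 2 / 2)
  have hGpos : 0 < G := integral_exp_pos integrable_exp_neg_sq_div_two
  have hZ := cwZ_pos n
  have hk : a⁻¹ * 2 ^ n ≠ 0 := by positivity
  rw [← mul_div_mul_left (∫ x, g x * spinFactor (a * x) ^ n) _ hk, ← cwZ_mul_integral ha hna, ← sum_cwWeight_mul_smoothed ha hna,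
    ← mul_div_mul_right _ (cwZ n) hGpos.ne', ← sub_div, Finset.sum_mul, ← Finset.sum_sub_distrib,
    abs_div, abs_of_pos (mul_pos hZ hGpos), div_le_iff₀ (mul_pos hZ hGpos)]
  calc _ ≤ ∑ σ : Fin n → Bool, cwWeight n σ * (L * a * M) := by
        refine (Finset.abs_sum_le_sum_abs _ _).trans (Finset.sum_le_sum fun σ _ => ?_)
        have hw : 0 < cwWeight n σ := Real.exp_pos _
        rw [mul_assoc, ← mul_sub, abs_mul, abs_of_pos hw]
        exact mul_le_mul_of_nonneg_left (abs_mul_integral_sub_smoothed_le g hL ha _) hw.le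
    _ = _ := by
        rw [← Finset.sum_mul, ← cwZ]
        field_simp

lemma tendsto_cwExpectation_of_lipschitz (g : BoundedContinuousFunction ℝ ℝ) {L : NNReal}
    (hL : LipschitzWith L g) :
    Tendsto
      (fun n : ℕ =>
        (∑ σ : Fin n → Bool, cwWeight n σ * g (totalSpin n σ / (n : ℝ) ^ ((3 : ℝ) / 4)))
          / cwZ n)
      atTop
      (𝓝 ((∫ x : ℝ, Real.exp (-x ^ 4 / 12))⁻¹ * ∫ x : ℝ, Real.exp (-x ^ 4 / 12) * g x)) := by
  have hden := tendsto_integral_mul_spinFactor_pow (BoundedContinuousFunction.const ℝ 1)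
  simp only [BoundedContinuousFunction.const_apply, one_mul] at hden
  have hratio := (tendsto_integral_mul_spinFactor_pow g).div hden integral_exp_neg_fourth_pos.ne'
  have hsmall : Tendsto (fun n : ℕ => L * quarterScale n *
      ((∫ z : ℝ, |z| * Real.exp (-z ^ 2 / 2)) / ∫ z : ℝ, Real.exp (-z ^ 2 / 2))) atTop (𝓝 0) := by
    simpa using (tendsto_quarterScale.const_mul (L : ℝ)).mul_const
      ((∫ z : ℝ, |z| * Real.exp (-z ^ 2 / 2)) / ∫ z : ℝ, Real.exp (-z ^ 2 / 2))
  have hdiff := squeeze_zero_norm' (f := fun n : ℕ =>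
      (∑ σ : Fin n → Bool, cwWeight n σ * g (totalSpin n σ / (n : ℝ) ^ ((3 : ℝ) / 4))) / cwZ n -
        (∫ x, g x * spinFactor (quarterScale n * x) ^ n) /
          ∫ x, spinFactor (quarterScale n * x) ^ n) (by
    filter_upwards [eventually_ge_atTop 1] with n hn
    simp_rw [div_rpow_eq_mul_quarterScale]
    exact abs_cwExpectation_sub_le (quarterScale_pos hn) (natCast_mul_quarterScale_pow_four hn)
      g hL) hsmall
  convert hdiff.add hratio using 2
  · simp
  · rw [zero_add, div_eq_inv_mul]
    simp_rw [mul_comm]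

/-- The law of `S_n / n^{3/4}` under the Curie–Weiss measure. -/
def cwLaw (n : ℕ) : Measure ℝ :=
  ∑ σ : Fin n → Bool, ENNReal.ofReal (cwWeight n σ / cwZ n) •
    Measure.dirac (totalSpin n σ / (n : ℝ) ^ ((3 : ℝ) / 4))

lemma cwWeight_div_cwZ_nonneg (n : ℕ) (σ : Fin n → Bool) : 0 ≤ cwWeight n σ / cwZ n :=
  div_nonneg (Real.exp_pos _).le (cwZ_pos n).le

instance isProbabilityMeasure_cwLaw (n : ℕ) : IsProbabilityMeasure (cwLaw n) := by
  constructor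
  simp only [cwLaw, Measure.finsetSum_apply, Measure.smul_apply, measure_univ, smul_eq_mul, mul_one]
  rw [← ENNReal.ofReal_sum_of_nonneg fun σ _ => cwWeight_div_cwZ_nonneg n σ, ← Finset.sum_div,
    ← cwZ, div_self (cwZ_pos n).ne', ENNReal.ofReal_one]

lemma integral_cwLaw (n : ℕ) (g : ℝ → ℝ) :
    ∫ x, g x ∂cwLaw n =
      (∑ σ : Fin n → Bool, cwWeight n σ * g (totalSpin n σ / (n : ℝ) ^ ((3 : ℝ) / 4)))
        / cwZ n := by
  rw [cwLaw, integral_finsetSum_measure fun σ _ =>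
    (integrable_dirac enorm_lt_top).smul_measure ENNReal.ofReal_ne_top, Finset.sum_div]
  refine Finset.sum_congr rfl fun σ _ => ?_
  rw [integral_smul_measure, integral_dirac,
    ENNReal.toReal_ofReal (cwWeight_div_cwZ_nonneg n σ), smul_eq_mul, div_mul_eq_mul_div]

/-- The probability measure on `ℝ` with density proportional to `exp(−x⁴/12)`. -/
def quarticLaw : Measure ℝ :=
  volume.withDensity fun x =>
    ENNReal.ofReal ((∫ x : ℝ, Real.exp (-x ^ 4 / 12))⁻¹ * Real.exp (-x ^ 4 / 12))

lemma quarticDensity_nonneg (x : ℝ) :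
    0 ≤ (∫ x : ℝ, Real.exp (-x ^ 4 / 12))⁻¹ * Real.exp (-x ^ 4 / 12) :=
  mul_nonneg (inv_pos.2 integral_exp_neg_fourth_pos).le (Real.exp_pos _).le

instance isProbabilityMeasure_quarticLaw : IsProbabilityMeasure quarticLaw := by
  constructor
  rw [quarticLaw, withDensity_apply _ MeasurableSet.univ, Measure.restrict_univ,
    ← ofReal_integral_eq_lintegral_ofReal (integrable_exp_neg_fourth.const_mul _)
      (.of_forall quarticDensity_nonneg), integral_const_mul,
    inv_mul_cancel₀ integral_exp_neg_fourth_pos.ne', ENNReal.ofReal_one]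

lemma integral_quarticLaw (g : ℝ → ℝ) :
    ∫ x, g x ∂quarticLaw =
      (∫ x : ℝ, Real.exp (-x ^ 4 / 12))⁻¹ * ∫ x : ℝ, Real.exp (-x ^ 4 / 12) * g x := by
  rw [quarticLaw, integral_withDensity_eq_integral_toReal_smul (by fun_prop)
    (.of_forall fun _ => ENNReal.ofReal_lt_top), ← integral_const_mul]
  congr 1 with x
  rw [ENNReal.toReal_ofReal (quarticDensity_nonneg x), smul_eq_mul, mul_assoc]

/-- **Ellis–Newman / Simon–Griffiths.** At the Curie–Weiss critical point, `S_n / n^{3/4}`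
converges in distribution to the non-Gaussian probability measure on `ℝ` with density
`C exp(−x⁴/12)`, where `C = (∫ exp(−x⁴/12) dx)⁻¹`: for every bounded continuous test
function `g`, the expectations of `g(S_n / n^{3/4})` converge to `∫ C exp(−x⁴/12) g(x) dx`. -/
theorem ellis_newman_curie_weiss (g : BoundedContinuousFunction ℝ ℝ) :
    Tendsto
      (fun n : ℕ =>
        (∑ σ : Fin n → Bool, cwWeight n σ * g (totalSpin n σ / (n : ℝ) ^ ((3 : ℝ) / 4)))
          / cwZ n)
      atTop
      (𝓝 ((∫ x : ℝ, Real.exp (-x ^ 4 / 12))⁻¹ * ∫ x : ℝ, Real.exp (-x ^ 4 / 12) * g x)) := by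
  have h : Tendsto (β := ProbabilityMeasure ℝ) (fun n => ⟨cwLaw n, inferInstance⟩) atTop
      (𝓝 (⟨quarticLaw, inferInstance⟩ : ProbabilityMeasure ℝ)) := by
    refine tendsto_iff_forall_lipschitz_integral_tendsto.2 ?_
    rintro f ⟨C, hC⟩ ⟨L, hL⟩
    simp only [ProbabilityMeasure.coe_mk, integral_cwLaw, integral_quarticLaw]
    exact tendsto_cwExpectation_of_lipschitz ⟨⟨f, hL.continuous⟩, C, hC⟩ hL
  have hg := ProbabilityMeasure.tendsto_iff_forall_integral_tendsto.1 h g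
  simpa only [ProbabilityMeasure.coe_mk, integral_cwLaw, integral_quarticLaw] using hg

end
end
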